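/- There exist absolute constants c, C > 0 such that the following holds. For every integer n ≥ 1, every real q with 0 < q < 1, and every s ∈ {1,…,n}, if π is a random permutation with the Mallows distribution μ_{n,q}, then c · min{q/(1−q)^4, (n−1)^2} ≤ Var(|C_s(π)|) ≤ C · min{q/(1−q)^4, (n−1)^2}. -/

import Mathlib

open Finset
open scoped Classical BigOperators

noncomputable section

/-- Number of inversions of a permutation of `Fin n` (0-indexed positions). -/
def invCount (n : ℕ) (π : Equiv.Perm (Fin n)) : ℕ :=
  ((Finset.univ : Finset (Fin n × Fin n)).filter
    (fun p => p.1 < p.2 ∧ π p.2 < π p.1)).card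

/-- Normalizing constant of the Mallows distribution. -/
def mallowsZ (n : ℕ) (q : ℝ) : ℝ :=
  ∑ σ : Equiv.Perm (Fin n), q ^ invCount n σ

/-- Mallows probability of an individual permutation. -/
def mallowsP (n : ℕ) (q : ℝ) (π : Equiv.Perm (Fin n)) : ℝ :=
  q ^ invCount n π / mallowsZ n q

/-- Expectation of a real-valued functional under the Mallows distribution. -/
def mExp (n : ℕ) (q : ℝ) (X : Equiv.Perm (Fin n) → ℝ) : ℝ :=
  ∑ π : Equiv.Perm (Fin n), mallowsP n q π * X π

/-- Probability of an event under the Mallows distribution. -/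
def mProb (n : ℕ) (q : ℝ) (A : Equiv.Perm (Fin n) → Prop) : ℝ :=
  ∑ π : Equiv.Perm (Fin n), if A π then mallowsP n q π else 0

/-- Conditional probability of `A` given `B` under the Mallows distribution. -/
def mCondProb (n : ℕ) (q : ℝ) (A B : Equiv.Perm (Fin n) → Prop) : ℝ :=
  mProb n q (fun π => A π ∧ B π) / mProb n q B

/-- The set of points of the cycle of `π` containing `s`. -/
def cycleSet (n : ℕ) (π : Equiv.Perm (Fin n)) (s : Fin n) : Finset (Fin n) :=
  Finset.univ.filter (fun t => π.SameCycle s t)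

lemma self_mem_cycleSet (n : ℕ) (π : Equiv.Perm (Fin n)) (s : Fin n) :
    s ∈ cycleSet n π s :=
  Finset.mem_filter.mpr ⟨Finset.mem_univ _, Equiv.Perm.SameCycle.refl _ _⟩

/-- Maximal element of the cycle of `s`, in 1-indexed labelling `{1,…,n}`. -/
def cycMax (n : ℕ) (π : Equiv.Perm (Fin n)) (s : Fin n) : ℕ :=
  (cycleSet n π s).sup (fun t => (t : ℕ) + 1)

/-- Minimal element of the cycle of `s`, in 1-indexed labelling `{1,…,n}`. -/
def cycMin (n : ℕ) (π : Equiv.Perm (Fin n)) (s : Fin n) : ℕ :=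
  (cycleSet n π s).inf' ⟨s, self_mem_cycleSet n π s⟩ (fun t => (t : ℕ) + 1)

/-- Variance of a real-valued functional under the Mallows distribution. -/
def mVar (n : ℕ) (q : ℝ) (X : Equiv.Perm (Fin n) → ℝ) : ℝ :=
  mExp n q (fun π => (X π - mExp n q X) ^ 2)

open Equiv

/-! ### Inversions and transpositions -/

lemma invCount_eq_sum (n : ℕ) (π : Equiv.Perm (Fin n)) :
    invCount n π = ∑ x : Fin n, ∑ y : Fin n, if x < y ∧ π y < π x then 1 else 0 := by
  unfold invCount
  rw [Finset.card_filter, ← Finset.univ_product_univ, Finset.sum_product]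

lemma sum_split_two {n : ℕ} {i j : Fin n} (hij : i ≠ j) (g : Fin n → ℕ) :
    ∑ x, g x = g i + g j + ∑ x ∈ (Finset.univ.erase i).erase j, g x := by
  rw [← Finset.add_sum_erase Finset.univ g (Finset.mem_univ i),
    ← Finset.add_sum_erase (Finset.univ.erase i) g (a := j) (by simp [Ne.symm hij])]
  ring

lemma invCount_split {n : ℕ} {i j : Fin n} (hij : i < j) (π : Equiv.Perm (Fin n)) :
    invCount n π = (if π j < π i then 1 else 0) +
      ∑ l ∈ (Finset.univ.erase i).erase j,
        ((if i < l ∧ π l < π i then 1 else 0) + (if j < l ∧ π l < π j then 1 else 0) +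
         (if l < i ∧ π i < π l then 1 else 0) + (if l < j ∧ π j < π l then 1 else 0)) +
      ∑ x ∈ (Finset.univ.erase i).erase j, ∑ y ∈ (Finset.univ.erase i).erase j,
        (if x < y ∧ π y < π x then 1 else 0) := by
  rw [invCount_eq_sum, sum_split_two hij.ne, sum_split_two hij.ne, sum_split_two hij.ne]
  have : ∀ x, (∑ y : Fin n, if x < y ∧ π y < π x then 1 else 0) =
      (if x < i ∧ π i < π x then 1 else 0) + (if x < j ∧ π j < π x then 1 else 0) +
      ∑ y ∈ (Finset.univ.erase i).erase j, (if x < y ∧ π y < π x then 1 else 0) := fun x =>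
    sum_split_two hij.ne _
  simp only [this, Finset.sum_add_distrib]
  simp [hij, hij.not_gt]
  ring

lemma inv_swap {n : ℕ} {i j : Fin n} (hij : i < j) (π : Equiv.Perm (Fin n)) (h : π j < π i) :
    invCount n (π * swap i j) + 1 +
      2 * (Finset.univ.filter (fun l => i < l ∧ l < j ∧ π j < π l ∧ π l < π i)).card
      = invCount n π := by
  rw [invCount_split hij π, invCount_split hij (π * swap i j)]
  have e1 : (π * swap i j) i = π j := by simp
  have e2 : (π * swap i j) j = π i := by simp
  have e3 : ∀ l ∈ (Finset.univ.erase i).erase j, (π * swap i j) l = π l := by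
    intro l hl
    simp only [Finset.mem_erase] at hl
    simp [swap_apply_of_ne_of_ne hl.2.1 hl.1]
  have e4 : (Finset.univ.filter (fun l => i < l ∧ l < j ∧ π j < π l ∧ π l < π i)).card =
      ∑ l ∈ (Finset.univ.erase i).erase j,
        if i < l ∧ l < j ∧ π j < π l ∧ π l < π i then 1 else 0 := by
    rw [Finset.card_filter, sum_split_two hij.ne]; simp
  rw [e1, e2, e4, Finset.mul_sum]
  have e5 : ∑ x ∈ (Finset.univ.erase i).erase j, ∑ y ∈ (Finset.univ.erase i).erase j,
        (if x < y ∧ (π * swap i j) y < (π * swap i j) x then 1 else 0) =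
      ∑ x ∈ (Finset.univ.erase i).erase j, ∑ y ∈ (Finset.univ.erase i).erase j,
        (if x < y ∧ π y < π x then 1 else 0) :=
    Finset.sum_congr rfl fun x hx => Finset.sum_congr rfl fun y hy => by rw [e3 x hx, e3 y hy]
  rw [e5]
  have e6 : ∑ l ∈ (Finset.univ.erase i).erase j,
        ((if i < l ∧ π l < π i then 1 else 0) + (if j < l ∧ π l < π j then 1 else 0) +
         (if l < i ∧ π i < π l then 1 else 0) + (if l < j ∧ π j < π l then 1 else 0)) =
      ∑ l ∈ (Finset.univ.erase i).erase j,
        ((if i < l ∧ (π * swap i j) l < π j then 1 else 0) +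
         (if j < l ∧ (π * swap i j) l < π i then 1 else 0) +
         (if l < i ∧ π j < (π * swap i j) l then 1 else 0) +
         (if l < j ∧ π i < (π * swap i j) l then 1 else 0)) +
      ∑ l ∈ (Finset.univ.erase i).erase j,
        2 * (if i < l ∧ l < j ∧ π j < π l ∧ π l < π i then 1 else 0) := by
    rw [← Finset.sum_add_distrib]
    refine Finset.sum_congr rfl fun l hl => ?_
    rw [e3 l hl]
    simp only [Finset.mem_erase] at hl
    have h1 : π l ≠ π i := fun hh => hl.2.1 (π.injective hh)
    have h2 : π l ≠ π j := fun hh => hl.1 (π.injective hh)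
    have h3 := hl.1
    have h4 := hl.2.1
    rcases lt_trichotomy l i with a | a | a
    · have : l < j := a.trans hij
      simp [a, a.not_gt, this, this.not_gt]
      split_ifs <;> omega
    · exact absurd a h4
    · rcases lt_trichotomy l j with b | b | b
      · simp [a, a.not_gt, b, b.not_gt]
        split_ifs <;> omega
      · exact absurd b h3
      · simp [a, a.not_gt, b, b.not_gt]
        split_ifs <;> omega
  rw [e6]
  simp [h, h.not_gt]
  ring

lemma inv_swap_lt {n : ℕ} {i j : Fin n} (hij : i < j) (π : Equiv.Perm (Fin n)) (h : π j < π i) :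
    invCount n (π * swap i j) + 1 ≤ invCount n π := by
  have := inv_swap hij π h
  omega

lemma inv_swap_le {n : ℕ} {i j : Fin n} (hij : i < j) (π : Equiv.Perm (Fin n))
    (K : Finset (Fin n)) (hK : ∀ l, i < l → l < j → π i < π l → π l < π j → l ∈ K) :
    invCount n (π * swap i j) ≤ invCount n π + (1 + 2 * K.card) := by
  rcases lt_trichotomy (π i) (π j) with h | h | h
  · have := inv_swap hij (π * swap i j) (by simpa using h)
    rw [mul_assoc, swap_mul_self, mul_one] at this
    have h2 : (Finset.univ.filter (fun l => i < l ∧ l < j ∧ (π * swap i j) j < (π * swap i j) l ∧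
        (π * swap i j) l < (π * swap i j) i)).card ≤ K.card := by
      apply Finset.card_le_card
      intro l hl
      simp only [Finset.mem_filter, Finset.mem_univ, true_and] at hl
      obtain ⟨a, b, c, d⟩ := hl
      have e : (π * swap i j) l = π l := by simp [swap_apply_of_ne_of_ne a.ne' b.ne]
      rw [e] at c d
      simp at c d
      exact hK l a b c d
    omega
  · exact absurd (π.injective h) hij.ne
  · have := inv_swap hij π h
    omega

/-- Swapping two positions at distance at most `d` changes `inv` by at most `2d`. -/
lemma inv_mul_swap_le {n : ℕ} {i j : Fin n} (π : Equiv.Perm (Fin n)) (d : ℕ)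
    (h1 : (j : ℕ) ≤ i + d) (h2 : (i : ℕ) ≤ j + d) :
    invCount n (π * swap i j) ≤ invCount n π + 2 * d := by
  wlog hij : i ≤ j generalizing i j
  · rw [swap_comm]; exact this h2 h1 (le_of_not_ge hij)
  rcases hij.eq_or_lt with rfl | hij
  · simp; exact Nat.le_add_right _ _
  have := inv_swap_le hij π (Finset.Ioo i j) (by intro l a b _ _; simp [a, b])
  rw [Fin.card_Ioo] at this
  have : (i : ℕ) < j := hij
  omega

lemma invCount_inv (n : ℕ) (π : Equiv.Perm (Fin n)) : invCount n π⁻¹ = invCount n π := by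
  unfold invCount
  refine Finset.card_bij' (fun p _ => (π⁻¹ p.2, π⁻¹ p.1)) (fun p _ => (π p.2, π p.1)) ?_ ?_ ?_ ?_
  · intro p hp; simp at hp ⊢; exact ⟨hp.2, hp.1⟩
  · intro p hp; simp at hp ⊢; exact ⟨hp.2, hp.1⟩
  · intro p hp; simp
  · intro p hp; simp

lemma inv_swap_mul_le {n : ℕ} {i j : Fin n} (π : Equiv.Perm (Fin n)) (d : ℕ)
    (h1 : (j : ℕ) ≤ i + d) (h2 : (i : ℕ) ≤ j + d) :
    invCount n (swap i j * π) ≤ invCount n π + 2 * d := by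
  have := inv_mul_swap_le π⁻¹ d h1 h2
  rw [invCount_inv] at this
  rw [← invCount_inv]
  simpa [mul_inv_rev] using this

/-- Conjugation by the order reversal. -/
def revConj {n : ℕ} (π : Equiv.Perm (Fin n)) : Equiv.Perm (Fin n) :=
  Fin.revPerm * π * Fin.revPerm

lemma revConj_apply {n : ℕ} (π : Equiv.Perm (Fin n)) (x : Fin n) :
    revConj π x = Fin.rev (π (Fin.rev x)) := rfl

lemma revConj_revConj {n : ℕ} (π : Equiv.Perm (Fin n)) : revConj (revConj π) = π := by
  ext x; simp [revConj_apply]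

lemma invCount_revConj (n : ℕ) (π : Equiv.Perm (Fin n)) : invCount n (revConj π) = invCount n π := by
  unfold invCount
  refine Finset.card_bij' (fun p _ => (Fin.rev p.2, Fin.rev p.1))
    (fun p _ => (Fin.rev p.2, Fin.rev p.1)) ?_ ?_ ?_ ?_
  · intro p hp; simp [revConj_apply] at hp ⊢; exact ⟨hp.1, hp.2⟩
  · intro p hp; simp [revConj_apply] at hp ⊢; exact ⟨hp.1, hp.2⟩
  · intro p hp; simp
  · intro p hp; simp

/-! ### Basic facts about the measure -/

lemma mallowsZ_pos {n : ℕ} {q : ℝ} (hq : 0 < q) : 0 < mallowsZ n q :=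
  Finset.sum_pos (fun _ _ => pow_pos hq _) Finset.univ_nonempty

lemma mallowsP_pos {n : ℕ} {q : ℝ} (hq : 0 < q) (π : Equiv.Perm (Fin n)) : 0 < mallowsP n q π :=
  div_pos (pow_pos hq _) (mallowsZ_pos hq)

lemma sum_mallowsP {n : ℕ} {q : ℝ} (hq : 0 < q) : ∑ π, mallowsP n q π = 1 := by
  unfold mallowsP
  rw [← Finset.sum_div]
  exact div_self (mallowsZ_pos hq).ne'

lemma mallowsP_le {n : ℕ} {q : ℝ} (hq : 0 < q) (hq1 : q < 1) {π π' : Equiv.Perm (Fin n)} {k : ℕ}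
    (h : invCount n π' ≤ invCount n π + k) : q ^ k * mallowsP n q π ≤ mallowsP n q π' := by
  unfold mallowsP
  rw [← mul_div_assoc, ← pow_add]
  apply div_le_div_of_nonneg_right _ (mallowsZ_pos hq).le
  exact pow_le_pow_of_le_one hq.le hq1.le (by omega)

lemma mallowsP_le_q {n : ℕ} {q : ℝ} (hq : 0 < q) (hq1 : q < 1) {π π' : Equiv.Perm (Fin n)}
    (h : invCount n π' + 1 ≤ invCount n π) : mallowsP n q π ≤ q * mallowsP n q π' := by
  unfold mallowsP
  rw [← mul_div_assoc, ← pow_succ']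
  apply div_le_div_of_nonneg_right _ (mallowsZ_pos hq).le
  exact pow_le_pow_of_le_one hq.le hq1.le h

lemma mallowsP_eq {n : ℕ} {q : ℝ} {π π' : Equiv.Perm (Fin n)}
    (h : invCount n π' = invCount n π) : mallowsP n q π' = mallowsP n q π := by
  unfold mallowsP; rw [h]

lemma mProb_nonneg {n : ℕ} {q : ℝ} (hq : 0 < q) (A : Equiv.Perm (Fin n) → Prop) :
    0 ≤ mProb n q A :=
  Finset.sum_nonneg fun π _ => by split_ifs; exacts [(mallowsP_pos hq π).le, le_rfl]

lemma mProb_mono {n : ℕ} {q : ℝ} (hq : 0 < q) {A B : Equiv.Perm (Fin n) → Prop}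
    (h : ∀ π, A π → B π) : mProb n q A ≤ mProb n q B :=
  Finset.sum_le_sum fun π _ => by
    have := (mallowsP_pos hq π).le
    by_cases hA : A π
    · simp [hA, h π hA]
    · simp only [hA, if_false]; split_ifs <;> simp [this]

lemma mProb_true {n : ℕ} {q : ℝ} (hq : 0 < q) : mProb n q (fun _ => True) = 1 := by
  simp [mProb, sum_mallowsP hq]

lemma mProb_le_one {n : ℕ} {q : ℝ} (hq : 0 < q) (A : Equiv.Perm (Fin n) → Prop) :
    mProb n q A ≤ 1 := by
  rw [← mProb_true (n := n) hq]; exact mProb_mono hq fun _ _ => trivial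

lemma mProb_or_le {n : ℕ} {q : ℝ} (hq : 0 < q) (A B : Equiv.Perm (Fin n) → Prop) :
    mProb n q (fun π => A π ∨ B π) ≤ mProb n q A + mProb n q B := by
  unfold mProb
  rw [← Finset.sum_add_distrib]
  refine Finset.sum_le_sum fun π _ => ?_
  have := (mallowsP_pos hq π).le
  by_cases hA : A π <;> by_cases hB : B π <;> simp [hA, hB, this]

lemma mProb_exists_le {n : ℕ} {q : ℝ} (hq : 0 < q) {ι : Type*} (S : Finset ι)
    (A : ι → Equiv.Perm (Fin n) → Prop) :
    mProb n q (fun π => ∃ b ∈ S, A b π) ≤ ∑ b ∈ S, mProb n q (A b) := by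
  induction S using Finset.induction_on with
  | empty => simp [mProb]
  | insert a S ha ih =>
    rw [Finset.sum_insert ha]
    refine le_trans (le_trans (mProb_mono hq ?_) (mProb_or_le hq (A a) _)) (add_le_add_right ih _)
    rintro π ⟨b, hb, h⟩
    rcases Finset.mem_insert.1 hb with rfl | hb
    · exact Or.inl h
    · exact Or.inr ⟨b, hb, h⟩

lemma sum_mProb_le_one {n : ℕ} {q : ℝ} (hq : 0 < q) {ι : Type*} (S : Finset ι)
    (A : ι → Equiv.Perm (Fin n) → Prop)
    (h : ∀ π, ∀ b ∈ S, ∀ b' ∈ S, A b π → A b' π → b = b') :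
    ∑ b ∈ S, mProb n q (A b) ≤ 1 := by
  unfold mProb
  rw [Finset.sum_comm, ← sum_mallowsP (n := n) hq]
  refine Finset.sum_le_sum fun π _ => ?_
  rw [← Finset.sum_filter, Finset.sum_const, nsmul_eq_mul]
  have : (S.filter (fun b => A b π)).card ≤ 1 := by
    rw [Finset.card_le_one]
    intro a ha b hb
    simp only [Finset.mem_filter] at ha hb
    exact h π a ha.1 b hb.1 ha.2 hb.2
  have h2 : ((S.filter (fun b => A b π)).card : ℝ) ≤ 1 := by exact_mod_cast this
  nlinarith [mallowsP_pos hq π]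

/-- Transfer of probability along an injection. -/
lemma mProb_inj {n : ℕ} {q : ℝ} (hq : 0 < q) {A B : Equiv.Perm (Fin n) → Prop}
    (T : Equiv.Perm (Fin n) → Equiv.Perm (Fin n)) (r r' : ℝ)
    (hT : ∀ π, A π → B (T π)) (hinj : ∀ π π', A π → A π' → T π = T π' → π = π')
    (hr' : 0 ≤ r') (h : ∀ π, A π → r * mallowsP n q π ≤ r' * mallowsP n q (T π)) :
    r * mProb n q A ≤ r' * mProb n q B := by
  unfold mProb
  rw [← Finset.sum_filter, ← Finset.sum_filter, Finset.mul_sum, Finset.mul_sum]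
  calc ∑ π ∈ Finset.univ.filter A, r * mallowsP n q π
      ≤ ∑ π ∈ Finset.univ.filter A, r' * mallowsP n q (T π) :=
        Finset.sum_le_sum fun π hπ => h π (Finset.mem_filter.1 hπ).2
    _ = ∑ π ∈ (Finset.univ.filter A).image T, r' * mallowsP n q π := by
        rw [Finset.sum_image]
        intro a ha b hb hab
        simp at ha hb
        exact hinj a b ha hb hab
    _ ≤ _ := by
        apply Finset.sum_le_sum_of_subset_of_nonneg
        · intro x hx
          obtain ⟨π, hπ, rfl⟩ := Finset.mem_image.1 hx
          simp at hπ ⊢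
          exact hT π hπ
        · intro x _ _
          exact mul_nonneg hr' (mallowsP_pos hq x).le

lemma mProb_inv {n : ℕ} {q : ℝ} (A : Equiv.Perm (Fin n) → Prop) :
    mProb n q (fun π => A π⁻¹) = mProb n q A := by
  unfold mProb
  rw [← Equiv.sum_comp (Equiv.inv (Equiv.Perm (Fin n)))]
  refine Finset.sum_congr rfl fun π _ => ?_
  simp [mallowsP_eq (q := q) (invCount_inv n π)]

lemma mExp_mono {n : ℕ} {q : ℝ} (hq : 0 < q) {X Y : Equiv.Perm (Fin n) → ℝ}
    (h : ∀ π, X π ≤ Y π) : mExp n q X ≤ mExp n q Y :=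
  Finset.sum_le_sum fun π _ => mul_le_mul_of_nonneg_left (h π) (mallowsP_pos hq π).le

lemma mExp_nonneg {n : ℕ} {q : ℝ} (hq : 0 < q) {X : Equiv.Perm (Fin n) → ℝ}
    (h : ∀ π, 0 ≤ X π) : 0 ≤ mExp n q X :=
  Finset.sum_nonneg fun π _ => mul_nonneg (mallowsP_pos hq π).le (h π)

lemma mExp_add {n : ℕ} {q : ℝ} (X Y : Equiv.Perm (Fin n) → ℝ) :
    mExp n q (fun π => X π + Y π) = mExp n q X + mExp n q Y := by
  simp [mExp, mul_add, Finset.sum_add_distrib]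

lemma mExp_smul {n : ℕ} {q : ℝ} (c : ℝ) (X : Equiv.Perm (Fin n) → ℝ) :
    mExp n q (fun π => c * X π) = c * mExp n q X := by
  simp only [mExp, Finset.mul_sum]
  exact Finset.sum_congr rfl fun π _ => by ring

lemma mExp_const {n : ℕ} {q : ℝ} (hq : 0 < q) (c : ℝ) :
    mExp n q (fun _ => c) = c := by
  simp [mExp, ← Finset.sum_mul, sum_mallowsP hq]

lemma mExp_sum {n : ℕ} {q : ℝ} {ι : Type*} (S : Finset ι) (X : ι → Equiv.Perm (Fin n) → ℝ) :
    mExp n q (fun π => ∑ i ∈ S, X i π) = ∑ i ∈ S, mExp n q (X i) := by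
  simp only [mExp, Finset.mul_sum]
  exact Finset.sum_comm

lemma mExp_ite {n : ℕ} {q : ℝ} (A : Equiv.Perm (Fin n) → Prop) [DecidablePred A] :
    mExp n q (fun π => if A π then 1 else 0) = mProb n q A := by
  unfold mExp mProb
  refine Finset.sum_congr rfl fun π _ => ?_
  by_cases h : A π <;> simp [h]

lemma mExp_revConj {n : ℕ} {q : ℝ} (X : Equiv.Perm (Fin n) → ℝ) :
    mExp n q (fun π => X (revConj π)) = mExp n q X := by
  unfold mExp
  let e : Equiv.Perm (Fin n) ≃ Equiv.Perm (Fin n) :=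
    ⟨revConj, revConj, revConj_revConj, revConj_revConj⟩
  rw [← Equiv.sum_comp e (fun π => mallowsP n q π * X π)]
  refine Finset.sum_congr rfl fun π _ => ?_
  show _ = mallowsP n q (revConj π) * X (revConj π)
  rw [mallowsP_eq (invCount_revConj n π)]


/-! ### Cycles, first exits -/

/-- The maximal element of the cycle of `s`. -/
def mx {n : ℕ} (s : Fin n) (π : Equiv.Perm (Fin n)) : ℕ := (cycleSet n π s).sup (fun t => (t : ℕ))

lemma mem_cycleSet {n : ℕ} {π : Equiv.Perm (Fin n)} {s t : Fin n} :
    t ∈ cycleSet n π s ↔ π.SameCycle s t := by simp [cycleSet]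

lemma le_mx_of {n : ℕ} {s x : Fin n} {π : Equiv.Perm (Fin n)} (h : π.SameCycle s x) :
    (x : ℕ) ≤ mx s π := Finset.le_sup (f := fun t : Fin n => (t : ℕ)) (mem_cycleSet.2 h)

lemma self_le_mx {n : ℕ} (s : Fin n) (π : Equiv.Perm (Fin n)) : (s : ℕ) ≤ mx s π :=
  le_mx_of (Equiv.Perm.SameCycle.refl _ _)

lemma exists_mx {n : ℕ} (s : Fin n) (π : Equiv.Perm (Fin n)) :
    ∃ x : Fin n, π.SameCycle s x ∧ (x : ℕ) = mx s π := by
  obtain ⟨x, hx, h⟩ := Finset.exists_mem_eq_sup (cycleSet n π s) ⟨s, self_mem_cycleSet n π s⟩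
    (fun t : Fin n => (t : ℕ))
  exact ⟨x, mem_cycleSet.1 hx, h.symm⟩

lemma mx_lt {n : ℕ} (s : Fin n) (π : Equiv.Perm (Fin n)) : mx s π < n := by
  obtain ⟨x, _, h⟩ := exists_mx s π
  rw [← h]; exact x.2

lemma le_mx_iff {n : ℕ} {s : Fin n} {π : Equiv.Perm (Fin n)} {u : ℕ} :
    u ≤ mx s π ↔ ∃ x : Fin n, π.SameCycle s x ∧ u ≤ (x : ℕ) := by
  constructor
  · intro h
    obtain ⟨x, hx, e⟩ := exists_mx s π
    exact ⟨x, hx, e ▸ h⟩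
  · rintro ⟨x, hx, h⟩
    exact h.trans (le_mx_of hx)

lemma mx_inv {n : ℕ} (s : Fin n) (π : Equiv.Perm (Fin n)) : mx s π⁻¹ = mx s π := by
  unfold mx cycleSet
  simp [Equiv.Perm.sameCycle_inv]

lemma le_mx_iff_pow {n : ℕ} {s : Fin n} {π : Equiv.Perm (Fin n)} {u : ℕ} :
    u ≤ mx s π ↔ ∃ i : ℕ, u ≤ ((π ^ (i + 1)) s : ℕ) := by
  rw [le_mx_iff]
  constructor
  · rintro ⟨x, hx, h⟩
    obtain ⟨i, hi0, hi1, rfl⟩ := hx.exists_pow_eq'' 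
    exact ⟨i - 1, by rwa [Nat.sub_add_cancel hi0]⟩
  · rintro ⟨i, h⟩
    exact ⟨_, ⟨(i + 1 : ℕ), by rw [zpow_natCast]⟩, h⟩

/-- Number of steps before the first exit from `[0,u)`. -/
def exitN {n : ℕ} (u : ℕ) (s : Fin n) (π : Equiv.Perm (Fin n)) : ℕ :=
  if h : ∃ i : ℕ, u ≤ ((π ^ (i + 1)) s : ℕ) then Nat.find h else 0

/-- The last point of the orbit of `s` before the first exit from `[0,u)`. -/
def tail {n : ℕ} (u : ℕ) (s : Fin n) (π : Equiv.Perm (Fin n)) : Fin n := (π ^ exitN u s π) s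

lemma exitN_spec {n : ℕ} {u : ℕ} {s : Fin n} {π : Equiv.Perm (Fin n)} (h : u ≤ mx s π) :
    u ≤ ((π ^ (exitN u s π + 1)) s : ℕ) ∧ ∀ j < exitN u s π, ((π ^ (j + 1)) s : ℕ) < u := by
  have h' := le_mx_iff_pow.1 h
  unfold exitN
  rw [dif_pos h']
  exact ⟨Nat.find_spec h', fun j hj => not_le.1 (Nat.find_min h' hj)⟩

lemma exitN_unique {n : ℕ} {u : ℕ} {s : Fin n} {π : Equiv.Perm (Fin n)} {N : ℕ}
    (h1 : u ≤ ((π ^ (N + 1)) s : ℕ)) (h2 : ∀ j < N, ((π ^ (j + 1)) s : ℕ) < u) :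
    exitN u s π = N := by
  have h' : ∃ i : ℕ, u ≤ ((π ^ (i + 1)) s : ℕ) := ⟨N, h1⟩
  unfold exitN
  rw [dif_pos h', Nat.find_eq_iff]
  exact ⟨h1, fun j hj => not_le.2 (h2 j hj)⟩

lemma path_lt {n : ℕ} {u : ℕ} {s : Fin n} {π : Equiv.Perm (Fin n)} (h : u ≤ mx s π)
    {j : ℕ} (hj : j ≤ exitN u s π) : ((π ^ j) s : ℕ) < u ∨ (π ^ j) s = s := by
  cases j with
  | zero => right; simp
  | succ j => left; exact (exitN_spec h).2 j hj

lemma tail_lt {n : ℕ} {u : ℕ} {s : Fin n} {π : Equiv.Perm (Fin n)} (h : u ≤ mx s π) :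
    (tail u s π : ℕ) < u ∨ tail u s π = s := path_lt h le_rfl

lemma tail_lt' {n : ℕ} {u : ℕ} {s : Fin n} {π : Equiv.Perm (Fin n)} (h : u ≤ mx s π)
    (hs : (s : ℕ) < u) : (tail u s π : ℕ) < u := by
  rcases tail_lt h with h | h
  · exact h
  · rwa [h]

lemma le_apply_tail {n : ℕ} {u : ℕ} {s : Fin n} {π : Equiv.Perm (Fin n)} (h : u ≤ mx s π) :
    u ≤ (π (tail u s π) : ℕ) := by
  have := (exitN_spec h).1
  rw [pow_succ'] at this
  exact this

lemma sameCycle_tail {n : ℕ} (u : ℕ) (s : Fin n) (π : Equiv.Perm (Fin n)) :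
    π.SameCycle s (tail u s π) := ⟨(exitN u s π : ℕ), by rw [zpow_natCast]; rfl⟩

/-- The two permutations have the same restriction to the square of `[0,u)`. -/
def Agree {n : ℕ} (u : ℕ) (s : Fin n) (π π' : Equiv.Perm (Fin n)) : Prop :=
  ∀ x : Fin n, ((x : ℕ) < u ∨ x = s) → ((π x : ℕ) < u ∨ (π' x : ℕ) < u) → π x = π' x

lemma agree_path {n : ℕ} {u : ℕ} {s : Fin n} {π π' : Equiv.Perm (Fin n)} (hA : Agree u s π π')
    (h : u ≤ mx s π) : ∀ j ≤ exitN u s π, (π' ^ j) s = (π ^ j) s := by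
  intro j
  induction j with
  | zero => simp
  | succ j ih =>
    intro hj
    have h1 := ih (by omega)
    rw [pow_succ', pow_succ', Equiv.Perm.mul_apply, Equiv.Perm.mul_apply, h1]
    refine (hA _ (path_lt h (by omega)) (Or.inl ?_)).symm
    have := (exitN_spec h).2 j (by omega)
    rwa [pow_succ'] at this

lemma agree_exitN {n : ℕ} {u : ℕ} {s : Fin n} {π π' : Equiv.Perm (Fin n)} (hA : Agree u s π π')
    (h : u ≤ mx s π) : u ≤ mx s π' ∧ exitN u s π' = exitN u s π := by
  have hp := agree_path hA h
  have h1 : u ≤ ((π' ^ (exitN u s π + 1)) s : ℕ) := by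
    rw [pow_succ', Equiv.Perm.mul_apply, hp _ le_rfl]
    by_contra hc
    have h2 := hA ((π ^ exitN u s π) s) (path_lt h le_rfl) (Or.inr (not_le.1 hc))
    rw [← h2] at hc
    exact hc (le_apply_tail h)
  refine ⟨le_mx_iff_pow.2 ⟨_, h1⟩, exitN_unique h1 ?_⟩
  intro j hj
  rw [hp (j + 1) hj]
  exact (exitN_spec h).2 j hj

lemma agree_mx {n : ℕ} {u : ℕ} {s : Fin n} {π π' : Equiv.Perm (Fin n)} (hA : Agree u s π π')
    (h : u ≤ mx s π) : u ≤ mx s π' := (agree_exitN hA h).1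

lemma agree_tail {n : ℕ} {u : ℕ} {s : Fin n} {π π' : Equiv.Perm (Fin n)} (hA : Agree u s π π')
    (h : u ≤ mx s π) : tail u s π' = tail u s π := by
  unfold tail
  rw [(agree_exitN hA h).2]
  exact agree_path hA h _ le_rfl

lemma tail_of_mx {n : ℕ} {t s : Fin n} {π : Equiv.Perm (Fin n)} (h : mx s π = t) :
    π (tail t s π) = t := by
  apply Fin.ext
  apply le_antisymm
  · rw [← h]
    exact le_mx_of ((sameCycle_tail _ s π).trans ⟨1, by rw [zpow_one, h]⟩)
  · exact le_apply_tail h.ge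

lemma agree_swap {n : ℕ} {u s b c : Fin n} (π : Equiv.Perm (Fin n)) (hs : s < u) (hb : u ≤ b)
    (hc : u ≤ c) : Agree u s π (swap u c * π * swap u b) := by
  intro x hx h
  have hx' : x < u := by
    rcases hx with hx | rfl
    · exact hx
    · exact hs
  have e : (swap u c * π * swap u b) x = swap u c (π x) := by
    simp [swap_apply_of_ne_of_ne hx'.ne (hx'.trans_le hb).ne]
  rw [e] at h ⊢
  by_cases h1 : π x = u
  · rw [h1] at h; simp at h; exact absurd (Fin.lt_def.2 h) (not_lt.2 hc)
  by_cases h2 : π x = c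
  · rw [h2] at h; simp at h; exact absurd (Fin.lt_def.2 h) (not_lt.2 hc)
  rw [swap_apply_of_ne_of_ne h1 h2]

lemma agree_swap_left {n : ℕ} {u s c : Fin n} (π : Equiv.Perm (Fin n))
    (hc : u ≤ c) : Agree u s π (swap u c * π) := by
  intro x _ h
  have e : (swap u c * π) x = swap u c (π x) := by simp
  rw [e] at h ⊢
  by_cases h1 : π x = u
  · rw [h1] at h; simp at h; exact absurd (Fin.lt_def.2 h) (not_lt.2 hc)
  by_cases h2 : π x = c
  · rw [h2] at h; simp at h; exact absurd (Fin.lt_def.2 h) (not_lt.2 hc)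
  rw [swap_apply_of_ne_of_ne h1 h2]

/-- Opening the cycle at its maximum. -/
lemma open_exit {n : ℕ} {t s b c : Fin n} {π : Equiv.Perm (Fin n)} (h : mx s π = t) (hs : s < t)
    (hb : t ≤ b) (hc : t ≤ c) :
    (swap t c * π * swap t b) (tail t s (swap t c * π * swap t b)) = c := by
  rw [agree_tail (agree_swap π hs hb hc) h.ge]
  have h1 : tail t s π < t := tail_lt' h.ge hs
  simp [swap_apply_of_ne_of_ne h1.ne (h1.trans_le hb).ne, tail_of_mx h]

lemma open_exit_left {n : ℕ} {t s c : Fin n} {π : Equiv.Perm (Fin n)} (h : mx s π = t)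
    (hc : t ≤ c) :
    (swap t c * π) (tail t s (swap t c * π)) = c := by
  rw [agree_tail (agree_swap_left π hc) h.ge]
  simp [tail_of_mx h]

/-- Closing the cycle at `u`. -/
lemma close_mx {n : ℕ} {u s b c : Fin n} {π : Equiv.Perm (Fin n)} (h : u ≤ mx s π) (hs : s < u)
    (hc : π (tail u s π) = c) (hb : π⁻¹ (tail u s π⁻¹) = b) :
    mx s (swap u c * π * swap u b) = u := by
  have huc : u ≤ c := by rw [← hc]; exact le_apply_tail h
  have h' : (u : ℕ) ≤ mx s π⁻¹ := by rwa [mx_inv]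
  have hub : u ≤ b := by rw [← hb]; exact le_apply_tail h'
  set σ := swap u c * π * swap u b with hσ
  have hσi : σ⁻¹ = swap u b * π⁻¹ * swap u c := by
    rw [hσ]; simp [mul_inv_rev, mul_assoc]
  have hA := agree_swap π hs hub huc
  have hA' := agree_swap π⁻¹ hs huc hub
  rw [← hσ] at hA
  rw [← hσi] at hA'
  have t1 := agree_tail hA h
  have t2 := agree_tail hA' h'
  have m1 := agree_mx hA h
  have m2 := agree_mx hA' h'
  have a1 : tail u s π < u := tail_lt' h hs
  have a2 : tail u s π⁻¹ < u := tail_lt' h' hs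
  have c1 : σ (tail u s σ) = u := by
    rw [t1, hσ]
    simp [swap_apply_of_ne_of_ne a1.ne (a1.trans_le hub).ne, hc]
  have c2 : σ⁻¹ (tail u s σ⁻¹) = u := by
    rw [t2, hσi]
    rw [Equiv.Perm.mul_apply, Equiv.Perm.mul_apply,
      swap_apply_of_ne_of_ne a2.ne (a2.trans_le huc).ne, hb, swap_apply_right]
  set N := exitN u s σ
  set N' := exitN u s σ⁻¹
  have d1 : (σ ^ (N + 1)) s = u := by rw [pow_succ']; exact c1
  have d2 : (σ⁻¹ ^ (N' + 1)) s = u := by rw [pow_succ']; exact c2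
  have e : (σ ^ (N' + 1)) u = s := by
    rw [← d2, ← Equiv.Perm.mul_apply, inv_pow, mul_inv_cancel, Equiv.Perm.one_apply]
  have key : ∀ i : ℕ, (∃ j ≤ N, (σ ^ i) s = (σ ^ j) s) ∨ (∃ j ≤ N' + 1, (σ ^ i) s = (σ⁻¹ ^ j) s) := by
    intro i
    induction i with
    | zero => left; exact ⟨0, by omega, rfl⟩
    | succ i ih =>
      rw [pow_succ', Equiv.Perm.mul_apply]
      rcases ih with ⟨j, hj, hij⟩ | ⟨j, hj, hij⟩
      · rw [hij, ← Equiv.Perm.mul_apply, ← pow_succ']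
        rcases hj.eq_or_lt with rfl | hj
        · right; exact ⟨N' + 1, le_rfl, by rw [d1, d2]⟩
        · left; exact ⟨j + 1, hj, rfl⟩
      · rw [hij]
        cases j with
        | zero =>
          simp only [pow_zero, Equiv.Perm.one_apply]
          by_cases hN : N = 0
          · right; refine ⟨N' + 1, le_rfl, ?_⟩
            rw [d2, ← d1, hN]; simp
          · left; exact ⟨1, by omega, by simp⟩
        | succ j =>
          right; refine ⟨j, by omega, ?_⟩
          rw [pow_succ', Equiv.Perm.mul_apply]; exact σ.apply_symm_apply _
  apply le_antisymm
  · rw [← not_lt]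
    intro hlt
    have hlt' : (u : ℕ) + 1 ≤ mx s σ := hlt
    obtain ⟨i, hi⟩ := le_mx_iff_pow.1 hlt'
    rcases key (i + 1) with ⟨j, hj, hij⟩ | ⟨j, hj, hij⟩
    · rw [hij] at hi
      rcases path_lt m1 hj with h3 | h3
      · omega
      · rw [h3] at hi; have : (s : ℕ) < u := hs; omega
    · rw [hij] at hi
      rcases Nat.lt_or_ge N' j with h4 | h4
      · have : j = N' + 1 := by omega
        rw [this, d2] at hi; omega
      · rcases path_lt m2 h4 with h3 | h3
        · omega
        · rw [h3] at hi; have : (s : ℕ) < u := hs; omega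
  · exact m1

/-! ### Merging cycles -/

lemma sameCycle_merge {n : ℕ} {π : Equiv.Perm (Fin n)} {a b x : Fin n} (h : ¬ π.SameCycle a b)
    (hx : π.SameCycle a x) : (π * swap a b).SameCycle b x := by
  obtain ⟨i, hi0, _, rfl⟩ := hx.exists_pow_eq''
  obtain ⟨k, rfl⟩ : ∃ k, i = k + 1 := ⟨i - 1, by omega⟩
  have hb : (π * swap a b) b = π a := by simp
  clear hi0 hx
  rename_i hc
  clear hc
  induction k with
  | zero => exact ⟨1, by simp⟩
  | succ k ih =>
    by_cases e : (π ^ (k + 1)) a = a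
    · rw [pow_succ', Equiv.Perm.mul_apply, e]
      exact ⟨1, by simp⟩
    · have e2 : (π ^ (k + 1)) a ≠ b := fun hh => h ⟨(k + 1 : ℕ), by rw [zpow_natCast]; exact hh⟩
      have e3 : (π * swap a b) ((π ^ (k + 1)) a) = (π ^ (k + 1 + 1)) a := by
        rw [Equiv.Perm.mul_apply, swap_apply_of_ne_of_ne e e2, pow_succ' π (k + 1)]; rfl
      rw [← e3]
      exact ih.trans ⟨1, by simp⟩

lemma sameCycle_merge' {n : ℕ} {π : Equiv.Perm (Fin n)} {a b : Fin n} (h : ¬ π.SameCycle a b) :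
    (π * swap a b).SameCycle a b :=
  (sameCycle_merge h (Equiv.Perm.SameCycle.refl _ _)).symm

lemma cycleSet_merge {n : ℕ} {π : Equiv.Perm (Fin n)} {a b : Fin n} (h : ¬ π.SameCycle a b) :
    cycleSet n (π * swap a b) a = cycleSet n π a ∪ cycleSet n π b := by
  have hm := sameCycle_merge' h
  ext x
  simp only [mem_cycleSet, Finset.mem_union]
  constructor
  · intro hx
    obtain ⟨i, -, -, rfl⟩ := hx.exists_pow_eq''
    clear hx
    induction i with
    | zero => left; exact Equiv.Perm.SameCycle.refl _ _
    | succ i ih =>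
      rw [pow_succ', Equiv.Perm.mul_apply]
      set y := ((π * swap a b) ^ i) a
      by_cases ya : y = a
      · rw [ya]; right; exact ⟨1, by simp⟩
      by_cases yb : y = b
      · rw [yb]; left; exact ⟨1, by simp⟩
      have : (π * swap a b) y = π y := by
        rw [Equiv.Perm.mul_apply, swap_apply_of_ne_of_ne ya yb]
      rw [this]
      have hy : π.SameCycle y (π y) := ⟨1, by simp⟩
      rcases ih with ih | ih
      · exact Or.inl (ih.trans hy)
      · exact Or.inr (ih.trans hy)
  · rintro (hx | hx)
    · exact hm.trans (sameCycle_merge h hx)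
    · have := sameCycle_merge (fun hh => h hh.symm) hx
      rwa [swap_comm] at this

lemma card_merge {n : ℕ} {π : Equiv.Perm (Fin n)} {a b : Fin n} (h : ¬ π.SameCycle a b) :
    (cycleSet n (π * swap a b) a).card = (cycleSet n π a).card + (cycleSet n π b).card := by
  rw [cycleSet_merge h, Finset.card_union_of_disjoint]
  rw [Finset.disjoint_left]
  intro x hx hx'
  rw [mem_cycleSet] at hx hx'
  exact h (hx.trans hx'.symm)

/-- Splitting a cycle. -/
lemma not_sameCycle_split {n : ℕ} {π : Equiv.Perm (Fin n)} {a b : Fin n} (hab : a ≠ b)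
    (h : π.SameCycle a b) : ¬ (π * swap a b).SameCycle a b := by
  have hex : ∃ i : ℕ, (π ^ (i + 1)) b = a := by
    obtain ⟨i, hi0, _, hi⟩ := h.symm.exists_pow_eq''
    exact ⟨i - 1, by rwa [Nat.sub_add_cancel hi0]⟩
  set k := Nat.find hex with hk
  have hk1 : (π ^ (k + 1)) b = a := Nat.find_spec hex
  have hk2 : ∀ j < k, (π ^ (j + 1)) b ≠ a := fun j hj => Nat.find_min hex hj
  have hkb : ∀ j ≤ k, (π ^ (j + 1)) b ≠ b := by
    intro j hj hb
    rcases hj.eq_or_lt with rfl | hj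
    · exact hab (hk1.symm.trans hb)
    · refine hk2 (k - j - 1) (by omega) ?_
      have : (π ^ (k + 1)) b = (π ^ (k - j - 1 + 1)) ((π ^ (j + 1)) b) := by
        rw [← Equiv.Perm.mul_apply, ← pow_add]
        congr 2; omega
      rw [hb] at this
      rw [← this, hk1]
  have key : ∀ i : ℕ, ∃ j ≤ k, ((π * swap a b) ^ i) a = (π ^ (j + 1)) b := by
    intro i
    induction i with
    | zero => exact ⟨k, le_rfl, hk1.symm⟩
    | succ i ih =>
      obtain ⟨j, hj, hij⟩ := ih
      rw [pow_succ', Equiv.Perm.mul_apply, hij]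
      rcases hj.eq_or_lt with rfl | hj
      · refine ⟨0, by omega, ?_⟩
        rw [hk1]; simp
      · refine ⟨j + 1, hj, ?_⟩
        rw [Equiv.Perm.mul_apply, swap_apply_of_ne_of_ne (hk2 j hj) (hkb j hj.le),
          pow_succ' π (j + 1)]
        rfl
  intro hc
  obtain ⟨i, -, -, hi⟩ := hc.exists_pow_eq''
  obtain ⟨j, hj, hij⟩ := key i
  exact hkb j hj (hij.symm.trans hi)


/-! ### Probability estimates by injections -/

/-- Number of values in `[v, π p)` to the right of `p`. -/
def rho {n : ℕ} (v : ℕ) (p : Fin n) (π : Equiv.Perm (Fin n)) : ℕ :=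
  (Finset.univ.filter (fun j : Fin n => p < j ∧ v ≤ (π j : ℕ) ∧ π j < π p)).card

lemma decr_step {n : ℕ} {q : ℝ} (hq : 0 < q) (hq1 : q < 1) (E : Equiv.Perm (Fin n) → Prop)
    (p : Equiv.Perm (Fin n) → Fin n) (v : ℕ)
    (hinv : ∀ π, E π → ∀ j, p π < j → v ≤ (π j : ℕ) → π j < π (p π) →
      E (π * swap (p π) j) ∧ p (π * swap (p π) j) = p π) (k : ℕ) :
    mProb n q (fun π => E π ∧ k + 1 ≤ rho v (p π) π) ≤
      q * mProb n q (fun π => E π ∧ k ≤ rho v (p π) π) := by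
  have hJ : ∀ π, ∃ j, (E π ∧ k + 1 ≤ rho v (p π) π) →
      ((p π < j ∧ v ≤ (π j : ℕ) ∧ π j < π (p π)) ∧
        ∀ l, p π < l → v ≤ (π l : ℕ) → π l < π (p π) → π l ≤ π j) := by
    intro π
    by_cases h : E π ∧ k + 1 ≤ rho v (p π) π
    · have hne : (Finset.univ.filter
          (fun j : Fin n => p π < j ∧ v ≤ (π j : ℕ) ∧ π j < π (p π))).Nonempty := by
        rw [← Finset.card_pos]
        exact lt_of_lt_of_le (Nat.succ_pos k) h.2
      obtain ⟨j, hj, hm⟩ := Finset.exists_max_image _ (fun j => π j) hne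
      refine ⟨j, fun _ => ⟨by simpa using hj, fun l h1 h2 h3 => hm l (by simp [h1, h2, h3])⟩⟩
    · exact ⟨p π, fun h' => absurd h' h⟩
  choose J hJ using hJ
  have := mProb_inj (n := n) (q := q) hq (A := fun π => E π ∧ k + 1 ≤ rho v (p π) π)
    (B := fun π => E π ∧ k ≤ rho v (p π) π) (fun π => π * swap (p π) (J π)) 1 q ?_ ?_ hq.le ?_
  · simpa using this
  · rintro π hπ
    obtain ⟨⟨h1, h2, h3⟩, h4⟩ := hJ π hπ
    obtain ⟨e1, e2⟩ := hinv π hπ.1 (J π) h1 h2 h3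
    refine ⟨e1, ?_⟩
    simp only [e2]
    have hle : rho v (p π) π ≤ rho v (p π) (π * swap (p π) (J π)) + 1 := by
      unfold rho
      rw [← Nat.sub_le_iff_le_add]
      refine le_trans (Finset.pred_card_le_card_erase (a := J π)) (Finset.card_le_card ?_)
      intro l hl
      simp only [Finset.mem_erase, Finset.mem_filter, Finset.mem_univ, true_and] at hl ⊢
      obtain ⟨l0, l1, l2, l3⟩ := hl
      have el : (π * swap (p π) (J π)) l = π l := by
        rw [Equiv.Perm.mul_apply, swap_apply_of_ne_of_ne l1.ne' l0]
      have ep : (π * swap (p π) (J π)) (p π) = π (J π) := by simp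
      rw [el, ep]
      exact ⟨l1, l2, lt_of_le_of_ne (h4 l l1 l2 l3) (fun hh => l0 (π.injective hh))⟩
    have := hπ.2
    omega
  · -- injectivity
    have aux : ∀ π π', (E π ∧ k + 1 ≤ rho v (p π) π) → (E π' ∧ k + 1 ≤ rho v (p π') π') →
        π * swap (p π) (J π) = π' * swap (p π') (J π') → p π = p π' → π (p π) < π' (p π') → False := by
      intro π π' hπ hπ' he hp hlt
      obtain ⟨⟨h1, h2, h3⟩, h4⟩ := hJ π hπ
      obtain ⟨⟨h1', h2', h3'⟩, h4'⟩ := hJ π' hπ'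
      have a1 : (π' * swap (p π') (J π')) (J π) = π (p π) := by rw [← he]; simp
      have a2 : (π' * swap (p π') (J π')) (J π') = π' (p π') := by simp
      have a3 : (π * swap (p π) (J π)) (p π) = π (J π) := by simp
      have a4 : (π' * swap (p π') (J π')) (p π') = π' (J π') := by simp
      have hne : J π ≠ J π' := by
        intro hh
        rw [hh, a2] at a1
        exact hlt.ne a1.symm
      have a5 : π' (J π) = π (p π) := by
        rw [← a1, Equiv.Perm.mul_apply, swap_apply_of_ne_of_ne _ hne]
        rw [← hp]; exact h1.ne'
      have := h4' (J π) (hp ▸ h1) (by rw [a5]; exact h2.trans (le_of_lt h3)) (by rw [a5]; exact hlt)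
      rw [a5, ← a4, ← he, ← hp, a3] at this
      exact absurd h3 (not_lt.2 this)
    intro π π' hπ hπ' he
    have hp : p π = p π' := by
      obtain ⟨⟨h1, h2, h3⟩, h4⟩ := hJ π hπ
      obtain ⟨⟨h1', h2', h3'⟩, h4'⟩ := hJ π' hπ'
      have e := (hinv π hπ.1 (J π) h1 h2 h3).2
      have e' := (hinv π' hπ'.1 (J π') h1' h2' h3').2
      rw [← e, ← e', he]
    rcases lt_trichotomy (π (p π)) (π' (p π')) with h | h | h
    · exact (aux π π' hπ hπ' he hp h).elim
    · have a1 : (π' * swap (p π') (J π')) (J π) = π (p π) := by rw [← he]; simp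
      have a2 : (π' * swap (p π') (J π')) (J π') = π' (p π') := by simp
      have : J π = J π' := (π' * swap (p π') (J π')).injective (by rw [a1, a2, h])
      simp only [this, hp] at he
      exact mul_right_cancel he
    · exact (aux π' π hπ' hπ he.symm hp.symm h).elim
  · intro π hπ
    obtain ⟨⟨h1, h2, h3⟩, h4⟩ := hJ π hπ
    rw [one_mul]
    exact mallowsP_le_q hq hq1 (inv_swap_lt h1 π h3)

lemma decr {n : ℕ} {q : ℝ} (hq : 0 < q) (hq1 : q < 1) (E : Equiv.Perm (Fin n) → Prop)
    (p : Equiv.Perm (Fin n) → Fin n) (v : ℕ)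
    (hinv : ∀ π, E π → ∀ j, p π < j → v ≤ (π j : ℕ) → π j < π (p π) →
      E (π * swap (p π) j) ∧ p (π * swap (p π) j) = p π) (k : ℕ) :
    mProb n q (fun π => E π ∧ k ≤ rho v (p π) π) ≤ q ^ k * mProb n q E := by
  induction k with
  | zero => simp
  | succ k ih =>
    refine (decr_step hq hq1 E p v hinv k).trans ?_
    rw [pow_succ', mul_assoc]
    exact mul_le_mul_of_nonneg_left ih hq.le

lemma rho_zero_ge {n : ℕ} (i : Fin n) (π : Equiv.Perm (Fin n)) : (π i : ℕ) ≤ i + rho 0 i π := by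
  have h1 : (Finset.univ.filter (fun l : Fin n => π l < π i)).card = (π i : ℕ) := by
    rw [← Fin.card_Iio (π i)]
    refine Finset.card_bij' (fun l _ => π l) (fun l _ => π.symm l) ?_ ?_ ?_ ?_ <;> simp
  have h2 : (Finset.univ.filter (fun l : Fin n => π l < π i)) ⊆
      Finset.Iio i ∪ Finset.univ.filter (fun j : Fin n => i < j ∧ 0 ≤ (π j : ℕ) ∧ π j < π i) := by
    intro l hl
    simp at hl ⊢
    rcases lt_trichotomy l i with h | h | h
    · exact Or.inl h
    · rw [h] at hl; exact absurd hl (lt_irrefl _)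
    · exact Or.inr ⟨h, hl⟩
  have h3 := (Finset.card_le_card h2).trans (Finset.card_union_le _ _)
  rw [h1, Fin.card_Iio] at h3
  exact h3

/-- Long forward jumps from `i` are unlikely, even given that the cycle of `s` reaches `i`. -/
lemma jump {n : ℕ} {q : ℝ} (hq : 0 < q) (hq1 : q < 1) (s i : Fin n) (j : ℕ) :
    mProb n q (fun π => (i : ℕ) ≤ mx s π ∧ (i : ℕ) + j ≤ (π i : ℕ)) ≤
      q ^ j * mProb n q (fun π => (i : ℕ) ≤ mx s π) := by
  refine le_trans (mProb_mono hq ?_)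
    (decr hq hq1 (fun π => (i : ℕ) ≤ mx s π) (fun _ => i) 0 ?_ j)
  · rintro π ⟨h1, h2⟩
    have := rho_zero_ge i π
    exact ⟨h1, by omega⟩
  · intro π hπ l hl _ _
    refine ⟨?_, rfl⟩
    rcases lt_or_ge s i with hs | hs
    · refine agree_mx ?_ hπ
      intro x hx _
      have hx' : x < i := by
        rcases hx with hx | rfl
        · exact hx
        · exact hs
      rw [Equiv.Perm.mul_apply, swap_apply_of_ne_of_ne hx'.ne (hx'.trans hl).ne]
    · exact le_trans hs (self_le_mx s _)

/-- Number of arcs crossing `u`. -/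
def kap {n : ℕ} (u : ℕ) (π : Equiv.Perm (Fin n)) : ℕ :=
  (Finset.univ.filter (fun i : Fin n => (i : ℕ) < u ∧ u ≤ (π i : ℕ))).card

lemma exp_kap {n : ℕ} {q : ℝ} (hq : 0 < q) (hq1 : q < 1) (s : Fin n) (u : ℕ) :
    mExp n q (fun π => if u ≤ mx s π then (kap u π : ℝ) else 0) ≤
      ∑ i ∈ Finset.univ.filter (fun i : Fin n => (i : ℕ) < u),
        q ^ (u - (i : ℕ)) * mProb n q (fun π => (i : ℕ) ≤ mx s π) := by
  have h1 : ∀ π : Equiv.Perm (Fin n), (if u ≤ mx s π then (kap u π : ℝ) else 0) =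
      ∑ i ∈ Finset.univ.filter (fun i : Fin n => (i : ℕ) < u),
        if (u ≤ mx s π ∧ u ≤ (π i : ℕ)) then (1 : ℝ) else 0 := by
    intro π
    split_ifs with h
    · simp only [h, true_and]
      unfold kap
      rw [← Finset.filter_filter, Finset.card_filter]
      push_cast
      rfl
    · simp [h]
  simp only [h1]
  rw [mExp_sum]
  refine Finset.sum_le_sum fun i hi => ?_
  simp only [Finset.mem_filter, Finset.mem_univ, true_and] at hi
  rw [mExp_ite]
  refine le_trans (mProb_mono hq ?_) (jump hq hq1 s i (u - i))
  rintro π ⟨a, b⟩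
  exact ⟨by omega, by omega⟩

lemma kap_markov {n : ℕ} {q : ℝ} (hq : 0 < q) (s : Fin n) (u k : ℕ) :
    (k : ℝ) * mProb n q (fun π => u ≤ mx s π ∧ k < kap u π) ≤
      mExp n q (fun π => if u ≤ mx s π then (kap u π : ℝ) else 0) := by
  rw [← mExp_ite, ← mExp_smul]
  refine mExp_mono hq fun π => ?_
  by_cases h1 : u ≤ mx s π <;> by_cases h2 : k < kap u π <;> simp [h1, h2]
  exact h2.le

lemma exit_le {n : ℕ} {s : Fin n} {u : ℕ} {π : Equiv.Perm (Fin n)} (h : u ≤ mx s π)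
    (hs : (s : ℕ) < u) :
    (π (tail u s π) : ℕ) ≤ u + rho u (tail u s π) π + kap u π := by
  set a := tail u s π with ha
  have ha1 : (a : ℕ) < u := tail_lt' h hs
  have h0 : (Finset.univ.filter (fun l : Fin n => u ≤ (π l : ℕ) ∧ π l < π a)).card + u
      = (π a : ℕ) := by
    have h1 : (Finset.univ.filter (fun l : Fin n => u ≤ (π l : ℕ) ∧ π l < π a)).card
        = (Finset.Ico u (π a : ℕ)).card := by
      refine Finset.card_bij (fun l _ => (π l : ℕ)) ?_ ?_ ?_
      · intro l hl; simp at hl ⊢; exact hl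
      · intro l _ l' _ hh; exact π.injective (Fin.ext hh)
      · intro b hb
        simp only [Finset.mem_Ico] at hb
        refine ⟨π.symm ⟨b, hb.2.trans (π a).2⟩, ?_, ?_⟩
        · simp only [Finset.mem_filter, Finset.mem_univ, true_and, Equiv.apply_symm_apply]
          exact ⟨hb.1, Fin.lt_def.2 hb.2⟩
        · simp
    rw [h1, Nat.card_Ico]
    exact Nat.sub_add_cancel (le_apply_tail h)
  have h2 : (Finset.univ.filter (fun l : Fin n => u ≤ (π l : ℕ) ∧ π l < π a)) ⊆
      Finset.univ.filter (fun j : Fin n => a < j ∧ u ≤ (π j : ℕ) ∧ π j < π a) ∪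
      Finset.univ.filter (fun i : Fin n => (i : ℕ) < u ∧ u ≤ (π i : ℕ)) := by
    intro l hl
    simp only [Finset.mem_filter, Finset.mem_univ, true_and, Finset.mem_union] at hl ⊢
    rcases lt_trichotomy l a with h | h | h
    · exact Or.inr ⟨lt_trans h ha1, hl.1⟩
    · rw [h] at hl; exact absurd hl.2 (lt_irrefl _)
    · exact Or.inl ⟨h, hl⟩
  have h3 := (Finset.card_le_card h2).trans (Finset.card_union_le _ _)
  unfold rho kap
  omega

lemma exit_far {n : ℕ} {q : ℝ} (hq : 0 < q) (hq1 : q < 1) {s : Fin n} {u : ℕ} (hs : (s : ℕ) < u)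
    (j k : ℕ) :
    mProb n q (fun π => u ≤ mx s π ∧ u + k + j ≤ (π (tail u s π) : ℕ)) ≤
      q ^ j * mProb n q (fun π => u ≤ mx s π) + mProb n q (fun π => u ≤ mx s π ∧ k < kap u π) := by
  have h1 := decr hq hq1 (fun π => u ≤ mx s π) (fun π => tail u s π) u ?_ j
  · refine le_trans (mProb_mono hq ?_) ((mProb_or_le hq _ _).trans (add_le_add_left h1 _))
    rintro π ⟨a, b⟩
    have := exit_le a hs
    by_cases hk : k < kap u π
    · exact Or.inr ⟨a, hk⟩
    · exact Or.inl ⟨a, by omega⟩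
  · intro π hπ l hl hl1 hl2
    have hA : Agree u s π (π * swap (tail u s π) l) := by
      intro x _ hx
      by_cases x1 : x = tail u s π
      · rw [x1] at hx
        have := le_apply_tail hπ
        simp at hx
        omega
      by_cases x2 : x = l
      · rw [x2] at hx
        have := le_apply_tail hπ
        simp at hx
        omega
      rw [Equiv.Perm.mul_apply, swap_apply_of_ne_of_ne x1 x2]
    exact ⟨agree_mx hA hπ, agree_tail hA hπ⟩

lemma close_prob {n : ℕ} {q : ℝ} (hq : 0 < q) (hq1 : q < 1) {s u : Fin n} (hs : s < u) (m : ℕ) :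
    q ^ (4 * m) * mProb n q (fun π => (u : ℕ) ≤ mx s π ∧ (π (tail u s π) : ℕ) < u + m ∧
      (π⁻¹ (tail u s π⁻¹) : ℕ) < u + m) ≤ (m : ℝ) ^ 2 * mProb n q (fun π => mx s π = u) := by
  set S : Finset (Fin n) := Finset.univ.filter (fun c : Fin n => u ≤ c ∧ (c : ℕ) < u + m) with hS
  have hcard : S.card ≤ m := by
    have : S.card ≤ (Finset.Ico (u : ℕ) (u + m)).card := by
      refine Finset.card_le_card_of_injOn (fun c => (c : ℕ)) ?_ ?_
      · intro c hc; simp [hS] at hc ⊢; exact hc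
      · intro c _ c' _ hh; exact Fin.ext hh
    simpa using this
  have h1 : mProb n q (fun π => (u : ℕ) ≤ mx s π ∧ (π (tail u s π) : ℕ) < u + m ∧
      (π⁻¹ (tail u s π⁻¹) : ℕ) < u + m) ≤ ∑ β ∈ S ×ˢ S, mProb n q (fun π => (u : ℕ) ≤ mx s π ∧
        π (tail u s π) = β.1 ∧ π⁻¹ (tail u s π⁻¹) = β.2) := by
    refine le_trans (mProb_mono hq ?_) (mProb_exists_le hq (S ×ˢ S) _)
    rintro π ⟨a, b, c⟩
    refine ⟨(π (tail u s π), π⁻¹ (tail u s π⁻¹)), ?_, a, rfl, rfl⟩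
    simp only [Finset.mem_product, hS, Finset.mem_filter, Finset.mem_univ, true_and]
    exact ⟨⟨le_apply_tail a, b⟩, le_apply_tail (by rwa [mx_inv]), c⟩
  have h2 : ∀ β ∈ S ×ˢ S, q ^ (4 * m) * mProb n q (fun π => (u : ℕ) ≤ mx s π ∧
        π (tail u s π) = β.1 ∧ π⁻¹ (tail u s π⁻¹) = β.2) ≤ mProb n q (fun π => mx s π = u) := by
    rintro ⟨c, b⟩ hβ
    simp only [Finset.mem_product, hS, Finset.mem_filter, Finset.mem_univ, true_and] at hβ
    obtain ⟨⟨c1, c2⟩, b1, b2⟩ := hβ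
    rw [← one_mul (mProb n q (fun π => mx s π = u))]
    refine mProb_inj hq (fun π => swap u c * π * swap u b) _ 1 ?_ ?_ zero_le_one ?_
    · rintro π ⟨x, y, z⟩
      exact close_mx x hs y z
    · intro π π' _ _ he
      exact mul_left_cancel (mul_right_cancel he)
    · intro π _
      rw [one_mul]
      refine mallowsP_le hq hq1 ?_
      have hc' : (u : ℕ) ≤ c := c1
      have hb' : (u : ℕ) ≤ b := b1
      have e1 := inv_mul_swap_le (i := u) (j := b) (swap u c * π) m (by omega) (by omega)
      have e2 := inv_swap_mul_le (i := u) (j := c) π m (by omega) (by omega)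
      omega
  calc _ ≤ q ^ (4 * m) * ∑ β ∈ S ×ˢ S, mProb n q (fun π => (u : ℕ) ≤ mx s π ∧
        π (tail u s π) = β.1 ∧ π⁻¹ (tail u s π⁻¹) = β.2) :=
        mul_le_mul_of_nonneg_left h1 (pow_pos hq _).le
    _ ≤ ∑ β ∈ S ×ˢ S, mProb n q (fun π => mx s π = u) := by
        rw [Finset.mul_sum]; exact Finset.sum_le_sum h2
    _ = ((S.card : ℝ)) ^ 2 * mProb n q (fun π => mx s π = u) := by
        rw [Finset.sum_const, nsmul_eq_mul, Finset.card_product]; push_cast; ring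
    _ ≤ _ := by
        apply mul_le_mul_of_nonneg_right _ (mProb_nonneg hq _)
        have : (S.card : ℝ) ≤ m := by exact_mod_cast hcard
        gcongr

lemma card_window {n : ℕ} {t : Fin n} {d : ℕ} (htd : (t : ℕ) + d < n) :
    (Finset.univ.filter (fun c : Fin n => t ≤ c ∧ (c : ℕ) < t + d)).card = d := by
  have : (Finset.univ.filter (fun c : Fin n => t ≤ c ∧ (c : ℕ) < t + d)).card
      = (Finset.Ico (t : ℕ) (t + d)).card := by
    refine Finset.card_bij (fun c _ => (c : ℕ)) ?_ ?_ ?_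
    · intro c hc; simp at hc ⊢; exact hc
    · intro c _ c' _ hh; exact Fin.ext hh
    · intro b hb
      simp only [Finset.mem_Ico] at hb
      exact ⟨⟨b, by omega⟩, Finset.mem_filter.2 ⟨Finset.mem_univ _, Fin.le_def.2 hb.1, hb.2⟩, rfl⟩
  rw [this]; simp

lemma open_prob {n : ℕ} {q : ℝ} (hq : 0 < q) (hq1 : q < 1) {s t : Fin n} (hs : s < t) (d : ℕ)
    (htd : (t : ℕ) + d < n) :
    (d : ℝ) ^ 2 * (q ^ (4 * d) * mProb n q (fun π => mx s π = t)) ≤ 1 := by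
  set S : Finset (Fin n) := Finset.univ.filter (fun c : Fin n => t ≤ c ∧ (c : ℕ) < t + d) with hS
  have h2 : ∀ β ∈ S ×ˢ S, q ^ (4 * d) * mProb n q (fun π => mx s π = t) ≤
      mProb n q (fun π => π (tail t s π) = β.1 ∧ π⁻¹ (tail t s π⁻¹) = β.2) := by
    rintro ⟨c, b⟩ hβ
    simp only [Finset.mem_product, hS, Finset.mem_filter, Finset.mem_univ, true_and] at hβ
    obtain ⟨⟨c1, c2⟩, b1, b2⟩ := hβ
    rw [← one_mul (mProb n q (fun π => π (tail t s π) = _ ∧ _))]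
    refine mProb_inj hq (fun π => swap t c * π * swap t b) _ 1 ?_ ?_ zero_le_one ?_
    · intro π h
      refine ⟨open_exit h hs b1 c1, ?_⟩
      have : (swap t c * π * swap t b)⁻¹ = swap t b * π⁻¹ * swap t c := by
        simp [mul_inv_rev, mul_assoc]
      simp only [this]
      exact open_exit (by rwa [mx_inv]) hs c1 b1
    · intro π π' _ _ he
      exact mul_left_cancel (mul_right_cancel he)
    · intro π _
      rw [one_mul]
      refine mallowsP_le hq hq1 ?_
      have hc' : (t : ℕ) ≤ c := c1
      have hb' : (t : ℕ) ≤ b := b1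
      have e1 := inv_mul_swap_le (i := t) (j := b) (swap t c * π) d (by omega) (by omega)
      have e2 := inv_swap_mul_le (i := t) (j := c) π d (by omega) (by omega)
      omega
  have h3 := sum_mProb_le_one (n := n) (q := q) hq (S ×ˢ S)
    (fun β π => π (tail t s π) = β.1 ∧ π⁻¹ (tail t s π⁻¹) = β.2) (by
      rintro π ⟨b, b'⟩ _ ⟨c, c'⟩ _ ⟨h, h'⟩ ⟨k, k'⟩
      exact Prod.ext (h.symm.trans k) (h'.symm.trans k'))
  have h4 := (Finset.sum_le_sum h2).trans h3
  rw [Finset.sum_const, nsmul_eq_mul, Finset.card_product, card_window htd] at h4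
  push_cast at h4
  rwa [pow_two]

lemma open_prob_left {n : ℕ} {q : ℝ} (hq : 0 < q) (hq1 : q < 1) {s t : Fin n} (d : ℕ)
    (htd : (t : ℕ) + d < n) :
    (d : ℝ) * (q ^ (2 * d) * mProb n q (fun π => mx s π = t)) ≤ 1 := by
  set S : Finset (Fin n) := Finset.univ.filter (fun c : Fin n => t ≤ c ∧ (c : ℕ) < t + d) with hS
  have h2 : ∀ c ∈ S, q ^ (2 * d) * mProb n q (fun π => mx s π = t) ≤
      mProb n q (fun π => π (tail t s π) = c) := by
    intro c hβ
    simp only [hS, Finset.mem_filter, Finset.mem_univ, true_and] at hβ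
    obtain ⟨c1, c2⟩ := hβ
    rw [← one_mul (mProb n q (fun π => π (tail t s π) = _))]
    refine mProb_inj hq (fun π => swap t c * π) _ 1 ?_ ?_ zero_le_one ?_
    · intro π h
      exact open_exit_left h c1
    · intro π π' _ _ he
      exact mul_left_cancel he
    · intro π _
      rw [one_mul]
      refine mallowsP_le hq hq1 ?_
      have hc' : (t : ℕ) ≤ c := c1
      exact inv_swap_mul_le (i := t) (j := c) π d (by omega) (by omega)
  have h3 := sum_mProb_le_one (n := n) (q := q) hq S
    (fun c π => π (tail t s π) = c) (by
      intro π b _ c _ h h'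
      exact h.symm.trans h')
  have h4 := (Finset.sum_le_sum h2).trans h3
  rwa [Finset.sum_const, nsmul_eq_mul, card_window htd] at h4

lemma merge_prob {n : ℕ} {q : ℝ} (hq : 0 < q) (hq1 : q < 1) {s t : Fin n} (hs : s < t) (k : ℕ) :
    q ^ (1 + 2 * k) * mProb n q (fun π => ((t : ℕ) + 1 ≤ mx s π ∧ (t : ℕ) + 1 ≤ mx t π ∧
      kap (t + 1) π ≤ k) ∧ ¬ π.SameCycle s t) ≤ mProb n q (fun π => π.SameCycle s t) := by
  rw [← one_mul (mProb n q (fun π => π.SameCycle s t))]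
  set u : ℕ := (t : ℕ) + 1 with hu
  have hsu : (s : ℕ) < u := by have : (s : ℕ) < t := hs; omega
  have htu : (t : ℕ) < u := by omega
  have agr : ∀ π : Equiv.Perm (Fin n), ∀ y : Fin n, u ≤ mx s π → u ≤ mx t π →
      Agree u y π (π * swap (tail u s π) (tail u t π)) := by
    intro π y h1 h2 x _ hx
    have k1 := le_apply_tail h1
    have k2 := le_apply_tail h2
    by_cases x1 : x = tail u s π
    · rw [x1] at hx
      simp at hx
      omega
    by_cases x2 : x = tail u t π
    · rw [x2] at hx
      simp at hx
      omega
    rw [Equiv.Perm.mul_apply, swap_apply_of_ne_of_ne x1 x2]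
  refine mProb_inj hq (fun π => π * swap (tail u s π) (tail u t π)) _ 1 ?_ ?_ zero_le_one ?_
  · rintro π ⟨⟨h1, h2, h3⟩, h4⟩
    have hab : ¬ π.SameCycle (tail u s π) (tail u t π) := fun hh =>
      h4 ((sameCycle_tail u s π).trans (hh.trans (sameCycle_tail u t π).symm))
    have e1 := agree_tail (agr π s h1 h2) h1
    have e2 := agree_tail (agr π t h1 h2) h2
    have m := sameCycle_merge' hab
    have f1 := sameCycle_tail u s (π * swap (tail u s π) (tail u t π))
    have f2 := sameCycle_tail u t (π * swap (tail u s π) (tail u t π))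
    rw [e1] at f1
    rw [e2] at f2
    exact f1.trans (m.trans f2.symm)
  · rintro π π' ⟨⟨h1, h2, h3⟩, h4⟩ ⟨⟨h1', h2', h3'⟩, h4'⟩ he
    have e1 := agree_tail (agr π s h1 h2) h1
    have e2 := agree_tail (agr π t h1 h2) h2
    have e1' := agree_tail (agr π' s h1' h2') h1'
    have e2' := agree_tail (agr π' t h1' h2') h2'
    rw [he] at e1 e2
    rw [e1'] at e1
    rw [e2'] at e2
    rw [e1, e2] at he
    exact mul_right_cancel he
  · rintro π ⟨⟨h1, h2, h3⟩, h4⟩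
    rw [one_mul]
    refine mallowsP_le hq hq1 ?_
    have key : ∀ a b : Fin n, a < b → (b : ℕ) < u → u ≤ (π a : ℕ) → 
        invCount n (π * swap a b) ≤ invCount n π + (1 + 2 * k) := by
      intro a b hab hb ha
      have := inv_swap_le hab π (Finset.univ.filter (fun i : Fin n => (i : ℕ) < u ∧ u ≤ (π i : ℕ)))
        (by
          intro l l1 l2 l3 l4
          simp only [Finset.mem_filter, Finset.mem_univ, true_and]
          rw [Fin.lt_def] at l1 l2 l3 l4
          omega)
      have h3' : (Finset.univ.filter (fun i : Fin n => (i : ℕ) < u ∧ u ≤ (π i : ℕ))).card ≤ k := h3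
      omega
    have a1 := tail_lt' h1 hsu
    have a2 := tail_lt' h2 htu
    have b1 := le_apply_tail h1
    have b2 := le_apply_tail h2
    rcases lt_trichotomy (tail u s π) (tail u t π) with h | h | h
    · exact key _ _ h a2 b1
    · rw [h, swap_self]; exact Nat.le_add_right _ _
    · rw [swap_comm]; exact key _ _ h a1 b2


/-! ### Upper bound -/

/-- The recursive majorant of the crossing numbers. -/
def BB {n : ℕ} (q : ℝ) (s : Fin n) (u : ℕ) : ℝ :=
  ∑ i ∈ Finset.range u, q ^ (u - i) * mProb n q (fun π => i ≤ mx s π)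

lemma BB_succ {n : ℕ} (q : ℝ) (s : Fin n) (u : ℕ) :
    BB q s (u + 1) = q * (BB q s u + mProb n q (fun π => u ≤ mx s π)) := by
  unfold BB
  rw [Finset.sum_range_succ, mul_add, Finset.mul_sum]
  congr 1
  · refine Finset.sum_congr rfl fun i hi => ?_
    have hi := Finset.mem_range.1 hi
    rw [show u + 1 - i = (u - i) + 1 by omega, pow_succ]; ring
  · rw [show u + 1 - u = 1 by omega, pow_one]

lemma BB_nonneg {n : ℕ} {q : ℝ} (hq : 0 < q) (s : Fin n) (u : ℕ) : 0 ≤ BB q s u :=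
  Finset.sum_nonneg fun _ _ => mul_nonneg (pow_pos hq _).le (mProb_nonneg hq _)

lemma BB_le {n : ℕ} {q : ℝ} (hq : 0 < q) (hq1 : q < 1) (s : Fin n) (u : ℕ) :
    BB q s u ≤ q / (1 - q) := by
  have hε : 0 < 1 - q := by linarith
  induction u with
  | zero => simp [BB]; positivity
  | succ u ih =>
    rw [BB_succ]
    have := mProb_le_one hq (fun π : Equiv.Perm (Fin n) => u ≤ mx s π)
    calc q * (BB q s u + mProb n q (fun π => u ≤ mx s π)) ≤ q * (q / (1 - q) + 1) :=
          mul_le_mul_of_nonneg_left (add_le_add ih this) hq.le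
      _ = q / (1 - q) := by field_simp; ring

lemma exp_kap_BB {n : ℕ} {q : ℝ} (hq : 0 < q) (hq1 : q < 1) (s : Fin n) (u : ℕ) :
    mExp n q (fun π => if u ≤ mx s π then (kap u π : ℝ) else 0) ≤ BB q s u := by
  refine (exp_kap hq hq1 s u).trans ?_
  unfold BB
  rw [← Finset.sum_image (s := Finset.univ.filter (fun i : Fin n => (i : ℕ) < u))
    (g := fun i : Fin n => (i : ℕ))
    (f := fun i : ℕ => q ^ (u - i) * mProb n q (fun π => i ≤ mx s π))]
  · apply Finset.sum_le_sum_of_subset_of_nonneg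
    · intro x hx
      obtain ⟨i, hi, rfl⟩ := Finset.mem_image.1 hx
      simpa using hi
    · intro x _ _
      exact mul_nonneg (pow_pos hq _).le (mProb_nonneg hq _)
  · intro a _ b _ h
    exact Fin.ext h

/-- Summation identities for the recursion `A (j+1) = q (A j + p j)`. -/
lemma rec_sum (q : ℝ) (A p : ℕ → ℝ) (hA : ∀ j, A (j + 1) = q * (A j + p j)) (N : ℕ) :
    (1 - q) * ∑ j ∈ Finset.range N, A j + A N = A 0 + q * ∑ j ∈ Finset.range N, p j := by
  induction N with
  | zero => simp
  | succ N ih =>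
    rw [Finset.sum_range_succ, Finset.sum_range_succ, hA]
    linarith

lemma rec_sum_wt (q : ℝ) (A p : ℕ → ℝ) (hA : ∀ j, A (j + 1) = q * (A j + p j)) (N : ℕ) :
    (1 - q) * ∑ j ∈ Finset.range N, ((j : ℝ) + 1) * A j + N * A N =
      ∑ j ∈ Finset.range N, A j + q * ∑ j ∈ Finset.range N, ((j : ℝ) + 1) * p j := by
  induction N with
  | zero => simp
  | succ N ih =>
    rw [Finset.sum_range_succ, Finset.sum_range_succ, Finset.sum_range_succ, hA]
    push_cast
    linarith

lemma one_le_kap {n : ℕ} {s : Fin n} {u : ℕ} {π : Equiv.Perm (Fin n)} (h : u ≤ mx s π)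
    (hs : (s : ℕ) < u) : 1 ≤ kap u π := by
  unfold kap
  rw [Nat.succ_le_iff, Finset.card_pos]
  exact ⟨tail u s π, by simp [tail_lt' h hs, le_apply_tail h]⟩

lemma prob_le_BB {n : ℕ} {q : ℝ} (hq : 0 < q) (hq1 : q < 1) (s : Fin n) {u : ℕ}
    (hs : (s : ℕ) < u) : mProb n q (fun π => u ≤ mx s π) ≤ BB q s u := by
  refine le_trans ?_ (exp_kap_BB hq hq1 s u)
  rw [← mExp_ite]
  refine mExp_mono hq fun π => ?_
  split_ifs with h
  · exact_mod_cast one_le_kap h hs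
  · exact le_rfl

lemma prob_close {n : ℕ} {q : ℝ} (hq : 0 < q) (hq1 : q < 1) (s : Fin n) {u : ℕ}
    (hs : (s : ℕ) < u) (hu : u < n) (j k : ℕ) (hk : 0 < k) :
    mProb n q (fun π => u ≤ mx s π) ≤
      2 * (q ^ j * mProb n q (fun π => u ≤ mx s π)) + 2 * (BB q s u / k) +
      ((k + j : ℕ) : ℝ) ^ 2 / q ^ (4 * (k + j)) * mProb n q (fun π => mx s π = u) := by
  have hk' : (0 : ℝ) < k := by exact_mod_cast hk
  have e1 := exit_far hq hq1 hs j k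
  have e2 : mProb n q (fun π => u ≤ mx s π ∧ k < kap u π) ≤ BB q s u / k := by
    rw [le_div_iff₀ hk', mul_comm]
    exact (kap_markov hq s u k).trans (exp_kap_BB hq hq1 s u)
  have e3 : mProb n q (fun π => u ≤ mx s π ∧ u + k + j ≤ (π⁻¹ (tail u s π⁻¹) : ℕ)) =
      mProb n q (fun π => u ≤ mx s π ∧ u + k + j ≤ (π (tail u s π) : ℕ)) := by
    rw [← mProb_inv]
    simp only [inv_inv, mx_inv]
  have e4 := close_prob hq hq1 (s := s) (u := ⟨u, hu⟩) (Fin.lt_def.2 hs) (k + j)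
  simp only at e4
  have hqp : 0 < q ^ (4 * (k + j)) := pow_pos hq _
  rw [mul_comm, ← le_div_iff₀ hqp, mul_div_right_comm] at e4
  have e5 : mProb n q (fun π => u ≤ mx s π) ≤
      mProb n q (fun π => u ≤ mx s π ∧ u + k + j ≤ (π (tail u s π) : ℕ)) +
      (mProb n q (fun π => u ≤ mx s π ∧ u + k + j ≤ (π⁻¹ (tail u s π⁻¹) : ℕ)) +
       mProb n q (fun π => u ≤ mx s π ∧ (π (tail u s π) : ℕ) < u + (k + j) ∧
        (π⁻¹ (tail u s π⁻¹) : ℕ) < u + (k + j))) := by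
    refine le_trans (mProb_mono hq ?_) ((mProb_or_le hq _ _).trans
      (add_le_add_right (mProb_or_le hq _ _) _))
    intro π h
    by_cases a : u + k + j ≤ (π (tail u s π) : ℕ)
    · exact Or.inl ⟨h, a⟩
    by_cases b : u + k + j ≤ (π⁻¹ (tail u s π⁻¹) : ℕ)
    · exact Or.inr (Or.inl ⟨h, b⟩)
    · exact Or.inr (Or.inr ⟨h, by omega, by omega⟩)
  rw [e3] at e5
  linarith

lemma sum_ind (M N : ℕ) (h : M ≤ N) :
    ∑ j ∈ Finset.range N, (if j < M then (1 : ℝ) else 0) = M := by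
  rw [← Finset.sum_filter]
  have : (Finset.range N).filter (fun j => j < M) = Finset.range M := by
    ext x; simp; omega
  rw [this]; simp

lemma sum_ind_wt (M N : ℕ) (h : M ≤ N) :
    (M : ℝ) ^ 2 ≤ 2 * ∑ j ∈ Finset.range N, ((j : ℝ) + 1) * (if j < M then (1 : ℝ) else 0) := by
  simp only [mul_ite, mul_one, mul_zero]
  rw [← Finset.sum_filter]
  have : (Finset.range N).filter (fun j => j < M) = Finset.range M := by
    ext x; simp; omega
  rw [this]
  clear this h
  induction M with
  | zero => simp
  | succ M ih =>
    rw [Finset.sum_range_succ]; push_cast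
    nlinarith [(Nat.cast_nonneg M : (0 : ℝ) ≤ M)]

/-- `P(mx s ≥ s+1+j)`. -/
def pp {n : ℕ} (q : ℝ) (s : Fin n) (j : ℕ) : ℝ := mProb n q (fun π => (s : ℕ) + 1 + j ≤ mx s π)

lemma sum_eq_prob {n : ℕ} {q : ℝ} (hq : 0 < q) (s : Fin n) :
    ∑ j ∈ Finset.range (n - 1 - s), mProb n q (fun π => mx s π = (s : ℕ) + 1 + j) ≤ 1 := by
  apply sum_mProb_le_one hq
  intro π b _ b' _ h h'
  omega

lemma sum_eq_prob_wt {n : ℕ} {q : ℝ} (hq : 0 < q) (s : Fin n) :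
    ∑ j ∈ Finset.range (n - 1 - s), ((j : ℝ) + 1) * mProb n q (fun π => mx s π = (s : ℕ) + 1 + j)
      ≤ ∑ j ∈ Finset.range (n - 1 - s), pp q s j := by
  unfold pp
  simp only [← mExp_ite, ← mExp_smul]
  rw [← mExp_sum, ← mExp_sum]
  refine mExp_mono hq fun π => ?_
  have h1 := mx_lt s π
  have h0 := self_le_mx s π
  have h2 := sum_ind (mx s π - s) (n - 1 - s) (by omega)
  have h3 : ∀ j, ((s : ℕ) + 1 + j ≤ mx s π) ↔ j < mx s π - s := by intro j; omega
  simp only [h3]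
  rw [h2]
  rcases Nat.eq_zero_or_pos (mx s π - s) with h | h
  · rw [h]
    apply le_of_eq
    rw [Nat.cast_zero]
    refine Finset.sum_eq_zero fun j _ => ?_
    rw [if_neg (by omega), mul_zero]
  · rw [Finset.sum_eq_single (mx s π - s - 1)]
    · rw [if_pos (by omega), mul_one, Nat.cast_sub h]; simp
    · intro b _ hb
      rw [if_neg (by omega), mul_zero]
    · intro hb
      simp at hb
      omega

lemma exp_mx_sq {n : ℕ} {q : ℝ} (hq : 0 < q) (s : Fin n) :
    mExp n q (fun π => ((mx s π - s : ℕ) : ℝ) ^ 2) ≤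
      2 * ∑ j ∈ Finset.range (n - 1 - s), ((j : ℝ) + 1) * pp q s j := by
  unfold pp
  simp only [← mExp_ite, ← mExp_smul]
  rw [← mExp_sum, ← mExp_smul]
  refine mExp_mono hq fun π => ?_
  have h1 := mx_lt s π
  have h0 := self_le_mx s π
  have h3 : ∀ j, ((s : ℕ) + 1 + j ≤ mx s π) ↔ j < mx s π - s := by intro j; omega
  simp only [h3]
  exact sum_ind_wt _ _ (by omega)

/-- The absolute constant coming from `q^(-4m)`. -/
def R0 : ℝ := 169 * Real.exp 156

lemma q_pow_lower {q : ℝ} (hq : 1 / 3 ≤ q) (hq1 : q < 1) (m : ℕ) (c : ℝ)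
    (hm : (m : ℝ) * (1 - q) ≤ c) : Real.exp (-(3 * c)) ≤ q ^ m := by
  have hq0 : 0 < q := by linarith
  have h1 : Real.exp (-(3 * (1 - q))) ≤ q := by
    have h := Real.add_one_le_exp (1 / q - 1)
    have h2 : 1 / q - 1 ≤ 3 * (1 - q) := by
      rw [sub_le_iff_le_add, div_le_iff₀ hq0]
      nlinarith
    have h3 : 1 / q ≤ Real.exp (3 * (1 - q)) := by
      calc 1 / q = 1 / q - 1 + 1 := by ring
        _ ≤ _ := h
        _ ≤ _ := Real.exp_le_exp.2 h2
    rw [Real.exp_neg]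
    exact inv_le_of_inv_le₀ hq0 (by simpa using h3)
  calc Real.exp (-(3 * c)) ≤ Real.exp ((m : ℝ) * (-(3 * (1 - q)))) :=
        Real.exp_le_exp.2 (by nlinarith)
    _ = Real.exp (-(3 * (1 - q))) ^ m := Real.exp_nat_mul _ _
    _ ≤ q ^ m := pow_le_pow_left₀ (Real.exp_pos _).le h1 m

lemma q_pow_upper {q : ℝ} (hq : 0 < q) (j : ℕ) (hj : 3 ≤ (j : ℝ) * (1 - q)) : q ^ j ≤ 1 / 8 := by
  have h1 : q ≤ Real.exp (-(1 - q)) := by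
    have := Real.add_one_le_exp (-(1 - q)); linarith
  have h2 : q ^ j ≤ Real.exp (-3) := by
    calc q ^ j ≤ Real.exp (-(1 - q)) ^ j := pow_le_pow_left₀ hq.le h1 j
      _ = Real.exp ((j : ℝ) * (-(1 - q))) := (Real.exp_nat_mul _ _).symm
      _ ≤ _ := Real.exp_le_exp.2 (by linarith)
  refine h2.trans ?_
  rw [Real.exp_neg, one_div]
  apply inv_anti₀ (by norm_num)
  have h3 : Real.exp 3 = Real.exp 1 ^ 3 := by rw [← Real.exp_nat_mul]; norm_num
  rw [h3]
  have h4 : (2 : ℝ) ≤ Real.exp 1 := by have := Real.add_one_le_exp (1 : ℝ); linarith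
  calc (8 : ℝ) = 2 ^ 3 := by norm_num
    _ ≤ _ := pow_le_pow_left₀ (by norm_num) h4 3

set_option maxHeartbeats 2000000 in
lemma S1_bound {n : ℕ} {q : ℝ} (hq : 0 < q) (hq1 : q < 1) (s : Fin n) :
    ∑ j ∈ Finset.range (n - 1 - s), ((j : ℝ) + 1) * pp q s j ≤
      (100 * (1 + R0) ^ 2) * (q / (1 - q) ^ 4) := by
  set N := n - 1 - s with hN
  set A : ℕ → ℝ := fun j => BB q s ((s : ℕ) + 1 + j) with hA
  have hrec : ∀ j, A (j + 1) = q * (A j + pp q s j) := fun j => BB_succ q s _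
  have r1 := rec_sum q A (pp q s) hrec N
  have r2 := rec_sum_wt q A (pp q s) hrec N
  have hA0 : ∀ j, 0 ≤ A j := fun j => BB_nonneg hq s _
  have hA1 : A 0 ≤ q / (1 - q) := BB_le hq hq1 s _
  have hp0 : ∀ j, 0 ≤ pp q s j := fun j => mProb_nonneg hq _
  set S0 := ∑ j ∈ Finset.range N, pp q s j with hS0
  set S1 := ∑ j ∈ Finset.range N, ((j : ℝ) + 1) * pp q s j with hS1
  set T0 := ∑ j ∈ Finset.range N, A j with hT0
  set T1 := ∑ j ∈ Finset.range N, ((j : ℝ) + 1) * A j with hT1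
  have hS0n : 0 ≤ S0 := Finset.sum_nonneg fun j _ => hp0 j
  have hS1n : 0 ≤ S1 := Finset.sum_nonneg fun j _ => mul_nonneg (by positivity) (hp0 j)
  have hR0 : 0 < R0 := by unfold R0; positivity
  have hε : 0 < 1 - q := by linarith
  set e := 1 - q with he
  have t0 : e * T0 ≤ q / e + q * S0 := by linarith [hA0 N]
  have t1 : e * T1 ≤ T0 + q * S1 := by
    have := mul_nonneg (Nat.cast_nonneg N : (0 : ℝ) ≤ N) (hA0 N)
    linarith
  have t0' : e ^ 2 * T0 ≤ q + q * S0 * e := by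
    have := mul_le_mul_of_nonneg_left t0 hε.le
    have h2 : e * (q / e + q * S0) = q + q * S0 * e := by field_simp
    nlinarith
  rcases le_or_gt q (1 / 3) with hc | hc
  · -- small q
    have p0 : S0 ≤ T0 := Finset.sum_le_sum fun j _ => prob_le_BB hq hq1 s (by omega)
    have p1 : S1 ≤ T1 := Finset.sum_le_sum fun j _ =>
      mul_le_mul_of_nonneg_left (prob_le_BB hq hq1 s (by omega)) (by positivity)
    have he2 : 2 / 3 ≤ e := by linarith
    have he1 : e ≤ 1 := by linarith
    have a1 : S0 ≤ 9 * q := by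
      nlinarith [mul_le_mul_of_nonneg_left p0 (sq_nonneg e), mul_nonneg hS0n hε.le]
    have hqe : q / e ≤ 3 / 2 * q := by
      rw [div_le_iff₀ hε]; nlinarith
    have hqS : q * S0 ≤ 3 * q := by nlinarith
    have a2 : T0 ≤ 9 * q := by
      have : 2 / 3 * T0 ≤ e * T0 := mul_le_mul_of_nonneg_right he2 (hS0n.trans p0)
      linarith
    have a3 : S1 ≤ 27 * q := by nlinarith
    have a4 : q ≤ q / e ^ 4 := by
      rw [le_div_iff₀ (by positivity)]
      have : e ^ 4 ≤ 1 := pow_le_one₀ hε.le he1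
      nlinarith
    have a5 : 100 * (q / e ^ 4) ≤ 100 * (1 + R0) ^ 2 * (q / e ^ 4) := by
      apply mul_le_mul_of_nonneg_right _ (by positivity)
      nlinarith
    linarith
  · obtain ⟨k, hk1, hk2⟩ : ∃ k : ℕ, 8 ≤ (k : ℝ) * e ∧ (k : ℝ) * e ≤ 9 := by
      refine ⟨⌈8 / e⌉₊, ?_, ?_⟩
      · have := Nat.le_ceil (8 / e); rwa [div_le_iff₀ hε] at this
      · have := (Nat.ceil_lt_add_one (show 0 ≤ 8 / e by positivity)).le
        have h2 := mul_le_mul_of_nonneg_right this hε.le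
        rw [add_mul, div_mul_cancel₀ _ hε.ne'] at h2
        linarith
    obtain ⟨j, hj1, hj2⟩ : ∃ k : ℕ, 3 ≤ (k : ℝ) * e ∧ (k : ℝ) * e ≤ 4 := by
      refine ⟨⌈3 / e⌉₊, ?_, ?_⟩
      · have := Nat.le_ceil (3 / e); rwa [div_le_iff₀ hε] at this
      · have := (Nat.ceil_lt_add_one (show 0 ≤ 3 / e by positivity)).le
        have h2 := mul_le_mul_of_nonneg_right this hε.le
        rw [add_mul, div_mul_cancel₀ _ hε.ne'] at h2
        linarith
    have hk : 0 < k := by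
      rcases Nat.eq_zero_or_pos k with h | h
      · rw [h] at hk1; norm_num at hk1
      · exact h
    have hk' : (0 : ℝ) < k := by exact_mod_cast hk
    set R := ((k + j : ℕ) : ℝ) ^ 2 / q ^ (4 * (k + j)) with hR
    have hRn : 0 ≤ R := by positivity
    have hRb : R * e ^ 2 ≤ R0 := by
      have h1 : Real.exp (-(3 * 52)) ≤ q ^ (4 * (k + j)) := by
        refine q_pow_lower hc.le hq1 _ _ ?_
        push_cast; nlinarith
      have h2 : (((k + j : ℕ) : ℝ) * e) ^ 2 ≤ 169 := by
        have : ((k + j : ℕ) : ℝ) * e ≤ 13 := by push_cast; linarith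
        have h0 : 0 ≤ ((k + j : ℕ) : ℝ) * e := by positivity
        nlinarith
      rw [hR, div_mul_eq_mul_div, ← mul_pow, div_le_iff₀ (by positivity)]
      unfold R0
      calc _ ≤ (169 : ℝ) := h2
        _ = 169 * Real.exp 156 * Real.exp (-(3 * 52)) := by
          rw [mul_assoc, ← Real.exp_add]; norm_num
        _ ≤ _ := by gcongr
    clear_value R
    have main : ∀ i ∈ Finset.range N, pp q s i ≤ 1 / 4 * pp q s i + e / 4 * A i +
        R * mProb n q (fun π => mx s π = (s : ℕ) + 1 + i) := by
      intro i hi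
      have hi := Finset.mem_range.1 hi
      have := prob_close hq hq1 s (u := (s : ℕ) + 1 + i) (by omega) (by omega) j k hk
      rw [← hR] at this
      have b1 : q ^ j ≤ 1 / 8 := q_pow_upper hq j hj1
      have b2 : BB q s ((s : ℕ) + 1 + i) / k ≤ e / 8 * A i := by
        rw [div_le_iff₀ hk']
        show A i ≤ _
        nlinarith [hA0 i]
      have b3 := mul_le_mul_of_nonneg_right b1 (hp0 i)
      change pp q s i ≤ 2 * (q ^ j * pp q s i) + _ + _ at this
      linarith
    have s0 : S0 ≤ 1 / 4 * S0 + e / 4 * T0 + R := by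
      have := Finset.sum_le_sum main
      rw [Finset.sum_add_distrib, Finset.sum_add_distrib, ← Finset.mul_sum, ← Finset.mul_sum,
        ← Finset.mul_sum] at this
      have h2 := mul_le_mul_of_nonneg_left (sum_eq_prob hq s) hRn
      linarith
    have s1 : S1 ≤ 1 / 4 * S1 + e / 4 * T1 + R * S0 := by
      have h1 : S1 ≤ ∑ i ∈ Finset.range N, (1 / 4 * (((i : ℝ) + 1) * pp q s i) +
          e / 4 * (((i : ℝ) + 1) * A i) +
          R * (((i : ℝ) + 1) * mProb n q (fun π => mx s π = (s : ℕ) + 1 + i))) := by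
        refine Finset.sum_le_sum fun i hi => ?_
        have := mul_le_mul_of_nonneg_left (main i hi) (show (0 : ℝ) ≤ (i : ℝ) + 1 by positivity)
        linarith
      rw [Finset.sum_add_distrib, Finset.sum_add_distrib, ← Finset.mul_sum, ← Finset.mul_sum,
        ← Finset.mul_sum] at h1
      have h2 := mul_le_mul_of_nonneg_left (sum_eq_prob_wt hq s) hRn
      linarith
    have he1 : e ≤ 2 / 3 := by linarith
    -- bounds scaled by powers of e
    have c0 : S0 ≤ 1 / (2 * e) + 2 * R := by
      have x1 : q / e ≤ 1 / e := by gcongr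
      have x2 : q * S0 ≤ S0 := by nlinarith
      have x3 : 1 / (2 * e) = 1 / e / 2 := by field_simp
      rw [x3]; linarith
    have c0' : S0 * e ^ 2 ≤ 1 + 2 * R0 := by
      have := mul_le_mul_of_nonneg_right c0 (sq_nonneg e)
      have x3 : (1 / (2 * e) + 2 * R) * e ^ 2 = e / 2 + 2 * (R * e ^ 2) := by field_simp
      linarith
    have c1 : S1 ≤ T0 / 2 + 2 * R * S0 := by nlinarith
    have c2 : T0 * e ^ 4 ≤ 2 + 2 * R0 := by
      have y1 : T0 * e ^ 4 = (e ^ 2 * T0) * e ^ 2 := by ring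
      have y2 := mul_le_mul_of_nonneg_right t0' (sq_nonneg e)
      have y3 : (q + q * S0 * e) * e ^ 2 = q * e ^ 2 + q * e * (S0 * e ^ 2) := by ring
      have y4 : q * e ≤ 1 := by nlinarith
      have y5 : q * e ^ 2 ≤ 1 := by nlinarith
      have y6 : 0 ≤ S0 * e ^ 2 := by positivity
      nlinarith
    have c3 : (R * S0) * e ^ 4 ≤ R0 * (1 + 2 * R0) := by
      have y1 : (R * S0) * e ^ 4 = (R * e ^ 2) * (S0 * e ^ 2) := by ring
      rw [y1]
      exact mul_le_mul hRb c0' (by positivity) hR0.le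
    have c4 : S1 * e ^ 4 ≤ 10 * (1 + R0) ^ 2 := by
      have := mul_le_mul_of_nonneg_right c1 (show 0 ≤ e ^ 4 by positivity)
      nlinarith
    rw [← mul_div_assoc, le_div_iff₀ (by positivity)]
    nlinarith [sq_nonneg (1 + R0)]


lemma mVar_le {n : ℕ} {q : ℝ} (hq : 0 < q) (X : Equiv.Perm (Fin n) → ℝ) (a : ℝ) :
    mVar n q X ≤ mExp n q (fun π => (X π - a) ^ 2) := by
  have h : mExp n q (fun π => (X π - a) ^ 2) = mVar n q X + (mExp n q X - a) ^ 2 := by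
    unfold mVar
    set m := mExp n q X with hm
    have e1 : (fun π => (X π - a) ^ 2) =
        fun π => (X π - m) ^ 2 + ((2 * (m - a)) * X π + (a ^ 2 - m ^ 2)) := by
      funext π; ring
    rw [e1, mExp_add, mExp_add, mExp_smul, mExp_const hq, ← hm]
    ring
  rw [h]
  nlinarith [sq_nonneg (mExp n q X - a)]

lemma sameCycle_revConj {n : ℕ} {π : Equiv.Perm (Fin n)} {s x : Fin n} (h : π.SameCycle s x) :
    (revConj π).SameCycle (Fin.rev s) (Fin.rev x) := by
  obtain ⟨i, _, _, rfl⟩ := h.exists_pow_eq''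
  refine ⟨(i : ℕ), ?_⟩
  rw [zpow_natCast]
  clear h
  rename_i h1 h2
  clear h1 h2
  induction i with
  | zero => simp
  | succ i ih => rw [pow_succ', Equiv.Perm.mul_apply, ih, pow_succ', Equiv.Perm.mul_apply,
      revConj_apply, Fin.rev_rev]

lemma card_le_mx {n : ℕ} (s : Fin n) (π : Equiv.Perm (Fin n)) :
    (cycleSet n π s).card ≤ 1 + (mx s π - s) +
      (mx (Fin.rev s) (revConj π) - (Fin.rev s : Fin n)) := by
  have h0 : cycleSet n π s ⊆ {s} ∪ (cycleSet n π s).filter (fun x => s < x) ∪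
      (cycleSet n π s).filter (fun x => x < s) := by
    intro x hx
    simp only [Finset.mem_union, Finset.mem_singleton, Finset.mem_filter]
    rcases lt_trichotomy x s with h | h | h
    · exact Or.inr ⟨hx, h⟩
    · exact Or.inl (Or.inl h)
    · exact Or.inl (Or.inr ⟨hx, h⟩)
  have h1 : ((cycleSet n π s).filter (fun x => s < x)).card ≤ mx s π - s := by
    rw [← Nat.card_Ioc]
    refine Finset.card_le_card_of_injOn (fun x : Fin n => (x : ℕ)) ?_ ?_
    · intro x hx
      simp only [Finset.coe_filter, Set.mem_setOf_eq] at hx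
      simp only [Finset.coe_Ioc, Set.mem_Ioc]
      exact ⟨hx.2, le_mx_of (mem_cycleSet.1 hx.1)⟩
    · intro a _ b _ h; exact Fin.ext h
  have h2 : ((cycleSet n π s).filter (fun x => x < s)).card ≤
      mx (Fin.rev s) (revConj π) - (Fin.rev s : Fin n) := by
    rw [← Nat.card_Ioc]
    refine Finset.card_le_card_of_injOn (fun x : Fin n => (Fin.rev x : ℕ)) ?_ ?_
    · intro x hx
      simp only [Finset.coe_filter, Set.mem_setOf_eq] at hx
      simp only [Finset.coe_Ioc, Set.mem_Ioc]
      refine ⟨?_, le_mx_of (sameCycle_revConj (mem_cycleSet.1 hx.1))⟩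
      have := hx.2
      rw [Fin.lt_def] at this
      rw [Fin.val_rev, Fin.val_rev]
      have := x.2; have := s.2
      omega
    · intro a _ b _ h
      exact Fin.rev_injective (Fin.ext h)
  have h3 := Finset.card_le_card h0
  have h4 := Finset.card_union_le ({s} ∪ (cycleSet n π s).filter (fun x => s < x))
    ((cycleSet n π s).filter (fun x => x < s))
  have h5 := Finset.card_union_le {s} ((cycleSet n π s).filter (fun x => s < x))
  rw [Finset.card_singleton] at h5
  omega

lemma one_le_card {n : ℕ} (s : Fin n) (π : Equiv.Perm (Fin n)) : 1 ≤ (cycleSet n π s).card :=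
  Finset.card_pos.2 ⟨s, self_mem_cycleSet n π s⟩

lemma card_le_n {n : ℕ} (s : Fin n) (π : Equiv.Perm (Fin n)) : (cycleSet n π s).card ≤ n := by
  simpa using Finset.card_le_univ (cycleSet n π s)

lemma upper {n : ℕ} {q : ℝ} (hn : 1 ≤ n) (hq : 0 < q) (hq1 : q < 1) (s : Fin n) :
    mVar n q (fun π => ((cycleSet n π s).card : ℝ)) ≤
      (800 * (1 + R0) ^ 2) * min (q / (1 - q) ^ 4) (((n : ℝ) - 1) ^ 2) := by
  have hR : 0 < R0 := by unfold R0; positivity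
  have hε : 0 < 1 - q := by linarith
  have hK : 1 ≤ 800 * (1 + R0) ^ 2 := by nlinarith
  have h0 := mVar_le hq (fun π => ((cycleSet n π s).card : ℝ)) 1
  rw [mul_min_of_nonneg _ _ (by linarith)]
  refine le_min ?_ ?_
  · refine h0.trans ?_
    have h1 : mExp n q (fun π => (((cycleSet n π s).card : ℝ) - 1) ^ 2) ≤
        mExp n q (fun π => 2 * ((mx s π - s : ℕ) : ℝ) ^ 2 +
          2 * ((mx (Fin.rev s) (revConj π) - (Fin.rev s : Fin n) : ℕ) : ℝ) ^ 2) := by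
      refine mExp_mono hq fun π => ?_
      have a := card_le_mx s π
      have b := one_le_card s π
      have a' : ((cycleSet n π s).card : ℝ) ≤ 1 + ((mx s π - s : ℕ) : ℝ) +
        ((mx (Fin.rev s) (revConj π) - (Fin.rev s : Fin n) : ℕ) : ℝ) := by exact_mod_cast a
      have b' : (1 : ℝ) ≤ (cycleSet n π s).card := by exact_mod_cast b
      generalize ((mx s π - s : ℕ) : ℝ) = x at *
      generalize ((mx (Fin.rev s) (revConj π) - (Fin.rev s : Fin n) : ℕ) : ℝ) = y at *
      generalize ((cycleSet n π s).card : ℝ) = z at *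
      have : (z - 1) ^ 2 ≤ (x + y) ^ 2 := pow_le_pow_left₀ (by linarith) (by linarith) 2
      nlinarith [sq_nonneg (x - y)]
    rw [mExp_add, mExp_smul, mExp_smul, mExp_revConj (fun π =>
      ((mx (Fin.rev s) π - (Fin.rev s : Fin n) : ℕ) : ℝ) ^ 2)] at h1
    have h2 := exp_mx_sq hq s
    have h3 := exp_mx_sq hq (Fin.rev s)
    have h4 := S1_bound hq hq1 s
    have h5 := S1_bound hq hq1 (Fin.rev s)
    linarith
  · refine h0.trans ?_
    have h1 : mExp n q (fun π => (((cycleSet n π s).card : ℝ) - 1) ^ 2) ≤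
        mExp n q (fun _ => ((n : ℝ) - 1) ^ 2) := by
      refine mExp_mono hq fun π => ?_
      have b' : (1 : ℝ) ≤ (cycleSet n π s).card := by exact_mod_cast one_le_card s π
      have c' : ((cycleSet n π s).card : ℝ) ≤ n := by exact_mod_cast card_le_n s π
      exact pow_le_pow_left₀ (by linarith) (by linarith) 2
    rw [mExp_const hq] at h1
    nlinarith [sq_nonneg ((n : ℝ) - 1)]


/-! ### Variance lower bound reduction -/

lemma mExp_comp_le {n : ℕ} {q : ℝ} (hq : 0 < q) (hq1 : q < 1)
    (T : Equiv.Perm (Fin n) → Equiv.Perm (Fin n)) (hT : Function.Injective T) (k : ℕ)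
    (hk : ∀ π, invCount n (T π) ≤ invCount n π + k) (f : Equiv.Perm (Fin n) → ℝ)
    (hf : ∀ π, 0 ≤ f π) : q ^ k * mExp n q (fun π => f (T π)) ≤ mExp n q f := by
  unfold mExp
  rw [Finset.mul_sum]
  calc ∑ π, q ^ k * (mallowsP n q π * f (T π)) ≤ ∑ π, mallowsP n q (T π) * f (T π) := by
        refine Finset.sum_le_sum fun π _ => ?_
        rw [← mul_assoc]
        exact mul_le_mul_of_nonneg_right (mallowsP_le hq hq1 (hk π)) (hf _)
    _ = ∑ π ∈ Finset.univ.image T, mallowsP n q π * f π := by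
        rw [Finset.sum_image]
        intro a _ b _ h
        exact hT h
    _ ≤ _ := Finset.sum_le_sum_of_subset_of_nonneg (Finset.subset_univ _)
        fun π _ _ => mul_nonneg (mallowsP_pos hq π).le (hf π)

/-- `s` and `r` are neighbours. -/
def Nb {n : ℕ} (s r : Fin n) : Prop := (r : ℕ) = s + 1 ∨ (s : ℕ) = r + 1

lemma Nb.ne {n : ℕ} {s r : Fin n} (h : Nb s r) : s ≠ r := by
  rintro rfl
  rcases h with h | h <;> omega

lemma inv_nb {n : ℕ} {s r : Fin n} (h : Nb s r) (π : Equiv.Perm (Fin n)) :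
    invCount n (π * swap s r) ≤ invCount n π + 1 := by
  have key : ∀ i j : Fin n, (j : ℕ) = i + 1 → invCount n (π * swap i j) ≤ invCount n π + 1 := by
    intro i j hij
    have := inv_swap_le (i := i) (j := j) (Fin.lt_def.2 (by omega)) π ∅ (by
      intro l l1 l2 _ _
      rw [Fin.lt_def] at l1 l2
      omega)
    simpa using this
  rcases h with h | h
  · exact key s r h
  · rw [swap_comm]; exact key r s h

lemma var_diff {n : ℕ} {q : ℝ} (hq : 0 < q) (hq1 : q < 1) {s r : Fin n} (h : Nb s r)
    (X : Equiv.Perm (Fin n) → ℝ) :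
    q / 4 * mExp n q (fun π => (X (π * swap s r) - X π) ^ 2) ≤ mVar n q X := by
  unfold mVar
  set m := mExp n q X
  have h1 := mExp_comp_le hq hq1 (fun π => π * swap s r) (mul_left_injective _) 1 (inv_nb h)
    (fun π => (X π - m) ^ 2) (fun π => sq_nonneg _)
  have h2 : mExp n q (fun π => (X (π * swap s r) - X π) ^ 2) ≤
      mExp n q (fun π => 2 * (X (π * swap s r) - m) ^ 2 + 2 * (X π - m) ^ 2) := by
    refine mExp_mono hq fun π => ?_
    nlinarith [sq_nonneg (X (π * swap s r) - m + (X π - m))]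
  rw [mExp_add, mExp_smul, mExp_smul] at h2
  have h3 : 0 ≤ mExp n q (fun π => (X π - m) ^ 2) := mExp_nonneg hq fun π => sq_nonneg _
  simp only [pow_one] at h1
  nlinarith

lemma card_split {n : ℕ} {s r : Fin n} (hne : s ≠ r) {π : Equiv.Perm (Fin n)}
    (h : π.SameCycle s r) : ¬ (π * swap s r).SameCycle s r ∧
    (cycleSet n π s).card = (cycleSet n (π * swap s r) s).card +
      (cycleSet n (π * swap s r) r).card := by
  have h1 := not_sameCycle_split hne h
  refine ⟨h1, ?_⟩
  have := card_merge h1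
  rwa [mul_assoc, swap_mul_self, mul_one] at this

lemma var_ge_q {n : ℕ} {q : ℝ} (hq : 0 < q) (hq1 : q < 1) {s r : Fin n} (h : Nb s r) :
    q / 4 ≤ mVar n q (fun π => ((cycleSet n π s).card : ℝ)) := by
  refine le_trans ?_ (var_diff hq hq1 h _)
  have : mExp n q (fun _ => (1 : ℝ)) ≤ mExp n q (fun π =>
      (((cycleSet n (π * swap s r) s).card : ℝ) - (cycleSet n π s).card) ^ 2) := by
    refine mExp_mono hq fun π => ?_
    by_cases hc : π.SameCycle s r
    · obtain ⟨_, h2⟩ := card_split h.ne hc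
      rw [h2]
      have : (1 : ℝ) ≤ (cycleSet n (π * swap s r) r).card := by exact_mod_cast one_le_card r _
      push_cast
      nlinarith
    · rw [card_merge hc]
      have : (1 : ℝ) ≤ (cycleSet n π r).card := by exact_mod_cast one_le_card r _
      push_cast
      nlinarith
  rw [mExp_const hq] at this
  nlinarith

lemma card_conj {n : ℕ} (s r : Fin n) (π : Equiv.Perm (Fin n)) :
    (cycleSet n (swap s r * (π * swap s r)) r).card = (cycleSet n π s).card := by
  have key : ∀ x, (swap s r * (π * swap s r)).SameCycle r x ↔ π.SameCycle s (swap s r x) := by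
    intro x
    have := Equiv.Perm.sameCycle_conj (f := π) (g := swap s r) (x := r) (y := x)
    rw [swap_inv, swap_apply_right, mul_assoc] at this
    exact this
  refine Finset.card_bij' (fun x _ => swap s r x) (fun x _ => swap s r x) ?_ ?_ ?_ ?_
  · intro x hx
    rw [mem_cycleSet] at hx ⊢
    exact (key x).1 hx
  · intro x hx
    rw [mem_cycleSet] at hx ⊢
    rw [key, swap_apply_self]
    exact hx
  · intro x _; simp
  · intro x _; simp

lemma sameCycle_conj_swap {n : ℕ} (s r : Fin n) (π : Equiv.Perm (Fin n)) :
    (swap s r * (π * swap s r)).SameCycle s r ↔ π.SameCycle s r := by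
  have := Equiv.Perm.sameCycle_conj (f := π) (g := swap s r) (x := s) (y := r)
  rw [swap_inv, swap_apply_right, swap_apply_left, mul_assoc] at this
  rw [this]
  exact Equiv.Perm.sameCycle_comm

lemma var_ge_sq {n : ℕ} {q : ℝ} (hq : 1 / 2 ≤ q) (hq1 : q < 1) {s r : Fin n} (h : Nb s r) :
    1 / 672 * mExp n q (fun π => ((cycleSet n π s).card : ℝ) ^ 2) ≤
      mVar n q (fun π => ((cycleSet n π s).card : ℝ)) := by
  have hq0 : 0 < q := by linarith
  set F : Equiv.Perm (Fin n) → ℝ :=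
    fun π => if π.SameCycle s r then 0 else ((cycleSet n π r).card : ℝ) ^ 2 with hF
  set G : Equiv.Perm (Fin n) → ℝ :=
    fun π => if π.SameCycle s r then 0 else ((cycleSet n π s).card : ℝ) ^ 2 with hG
  have hF0 : ∀ π, 0 ≤ F π := by intro π; simp only [hF]; split_ifs <;> positivity
  have hG0 : ∀ π, 0 ≤ G π := by intro π; simp only [hG]; split_ifs <;> positivity
  have e1 : q / 4 * mExp n q F ≤ mVar n q (fun π => ((cycleSet n π s).card : ℝ)) := by
    refine le_trans (mul_le_mul_of_nonneg_left ?_ (by linarith)) (var_diff hq0 hq1 h _)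
    refine mExp_mono hq0 fun π => ?_
    simp only [hF]
    split_ifs with hc
    · positivity
    · rw [card_merge hc]; push_cast; apply le_of_eq; ring
  have e2 : q ^ 4 * mExp n q G ≤ mExp n q F := by
    have := mExp_comp_le hq0 hq1 (fun π => swap s r * (π * swap s r))
      (fun a b hab => mul_right_cancel (mul_left_cancel hab)) 4 (by
        intro π
        have h1 : (s : ℕ) ≤ r + 1 := by rcases h with h | h <;> omega
        have h2 : (r : ℕ) ≤ s + 1 := by rcases h with h | h <;> omega
        have a := inv_swap_mul_le (i := s) (j := r) (π * swap s r) 1 h2 h1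
        have b := inv_mul_swap_le (i := s) (j := r) π 1 h2 h1
        omega) F hF0
    refine le_trans (le_of_eq ?_) this
    congr 2
    funext π
    simp only [hF, hG, sameCycle_conj_swap, card_conj]
  have e3 : mExp n q (fun π => ((cycleSet n π s).card : ℝ) ^ 2) ≤ mExp n q G +
      mExp n q (fun π => 2 * (G (π * swap s r) + F (π * swap s r))) := by
    rw [← mExp_add]
    refine mExp_mono hq0 fun π => ?_
    by_cases hc : π.SameCycle s r
    · obtain ⟨h1, h2⟩ := card_split h.ne hc
      simp only [hF, hG, hc, h1, if_true, if_false, h2]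
      push_cast
      nlinarith [sq_nonneg (((cycleSet n (π * swap s r) s).card : ℝ) -
        (cycleSet n (π * swap s r) r).card)]
    · have x1 := hG0 (π * swap s r)
      have x2 := hF0 (π * swap s r)
      have x3 : G π = ((cycleSet n π s).card : ℝ) ^ 2 := by simp [hG, hc]
      linarith
  have e4 := mExp_comp_le hq0 hq1 (fun π => π * swap s r) (mul_left_injective _) 1 (inv_nb h)
    (fun π => 2 * (G π + F π)) (fun π => by linarith [hF0 π, hG0 π])
  rw [mExp_smul 2 (fun π => G π + F π), mExp_add G F, pow_one] at e4
  have f0 : 0 ≤ mExp n q F := mExp_nonneg hq0 hF0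
  have g0 : 0 ≤ mExp n q G := mExp_nonneg hq0 hG0
  have q4 : 1 / 16 ≤ q ^ 4 := by
    calc (1 / 16 : ℝ) = (1 / 2) ^ 4 := by norm_num
      _ ≤ q ^ 4 := pow_le_pow_left₀ (by norm_num) hq 4
  have g1 : mExp n q G ≤ 16 * mExp n q F := by nlinarith
  have h0 : 0 ≤ mExp n q (fun π => 2 * (G (π * swap s r) + F (π * swap s r))) :=
    mExp_nonneg hq0 fun π => by linarith [hF0 (π * swap s r), hG0 (π * swap s r)]
  have k1 : mExp n q (fun π => 2 * (G (π * swap s r) + F (π * swap s r))) ≤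
      4 * (mExp n q G + mExp n q F) := by nlinarith
  nlinarith


/-! ### Lower bound on the second moment -/

/-- Absolute constants for the lower bound. -/
def LL : ℝ := Real.exp 12

/-- Lower bound for the connection probability. -/
def c1 : ℝ := Real.exp (-33) / 8

lemma one_le_LL : 1 ≤ LL := by unfold LL; exact Real.one_le_exp (by norm_num)

lemma c1_pos : 0 < c1 := by unfold c1; positivity

lemma c1_le_one : c1 ≤ 1 := by
  unfold c1
  have : Real.exp (-33) ≤ 1 := Real.exp_le_one_iff.2 (by norm_num)
  linarith

lemma LL_pow {q : ℝ} (hq : 1 / 2 ≤ q) (hq1 : q < 1) {d : ℕ} (hd : (d : ℝ) * (1 - q) ≤ 1) (e : ℕ)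
    (he : e ≤ 4 * d) : 1 ≤ LL * q ^ e := by
  have h1 : Real.exp (-(3 * 4)) ≤ q ^ (4 * d) := by
    refine q_pow_lower (by linarith) hq1 _ _ ?_
    push_cast; linarith
  have h2 : q ^ (4 * d) ≤ q ^ e := pow_le_pow_of_le_one (by linarith) hq1.le he
  unfold LL
  calc (1 : ℝ) = Real.exp 12 * Real.exp (-(3 * 4)) := by rw [← Real.exp_add]; norm_num
    _ ≤ _ := mul_le_mul_of_nonneg_left (h1.trans h2) (Real.exp_pos _).le

lemma prob_mx_eq {n : ℕ} {q : ℝ} (hq : 1 / 2 ≤ q) (hq1 : q < 1) {s t : Fin n} {d : ℕ}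
    (hd0 : 0 < d) (hd : (d : ℝ) * (1 - q) ≤ 1) (hs : s < t) (ht : (t : ℕ) + d < n) :
    mProb n q (fun π => mx s π = t) ≤ LL / (d : ℝ) ^ 2 := by
  have hd' : (0 : ℝ) < d := by exact_mod_cast hd0
  have h1 := open_prob (by linarith) hq1 hs d ht
  have h2 := LL_pow hq hq1 hd (4 * d) le_rfl
  have h3 := mProb_nonneg (n := n) (q := q) (by linarith) (fun π => mx s π = t)
  rw [le_div_iff₀ (by positivity)]
  generalize mProb n q (fun π => mx s π = t) = p at *
  have hL := one_le_LL
  calc p * (d : ℝ) ^ 2 ≤ (p * (d : ℝ) ^ 2) * (LL * q ^ (4 * d)) :=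
        le_mul_of_one_le_right (by positivity) h2
    _ = LL * ((d : ℝ) ^ 2 * (q ^ (4 * d) * p)) := by ring
    _ ≤ LL * 1 := mul_le_mul_of_nonneg_left h1 (by linarith)
    _ = LL := mul_one _

lemma prob_mx_self {n : ℕ} {q : ℝ} (hq : 1 / 2 ≤ q) (hq1 : q < 1) {s : Fin n} {d : ℕ}
    (hd0 : 0 < d) (hd : (d : ℝ) * (1 - q) ≤ 1) (ht : (s : ℕ) + d < n) :
    mProb n q (fun π => mx s π = s) ≤ LL / d := by
  have hd' : (0 : ℝ) < d := by exact_mod_cast hd0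
  have h1 := open_prob_left (q := q) (by linarith) hq1 (s := s) (t := s) d ht
  have h2 := LL_pow hq hq1 hd (2 * d) (by omega)
  have h3 := mProb_nonneg (n := n) (q := q) (by linarith) (fun π => mx s π = s)
  rw [le_div_iff₀ (by positivity)]
  generalize mProb n q (fun π => mx s π = s) = p at *
  have hL := one_le_LL
  calc p * (d : ℝ) ≤ (p * (d : ℝ)) * (LL * q ^ (2 * d)) :=
        le_mul_of_one_le_right (by positivity) h2
    _ = LL * ((d : ℝ) * (q ^ (2 * d) * p)) := by ring
    _ ≤ LL * 1 := mul_le_mul_of_nonneg_left h1 (by linarith)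
    _ = LL := mul_one _

lemma prob_connect {n : ℕ} {q : ℝ} (hq : 1 / 2 ≤ q) (hq1 : q < 1) {s t : Fin n} {d : ℕ}
    (hd0 : 8 * LL ≤ d) (hd : (d : ℝ) * (1 - q) ≤ 1) (hs : s < t) (ht : (t : ℕ) + d < n)
    (hts : ((t : ℝ) - s) * (4 * LL) ≤ (d : ℝ) ^ 2) :
    c1 ≤ mProb n q (fun π => π.SameCycle s t) := by
  have hq0 : 0 < q := by linarith
  have hε : 0 < 1 - q := by linarith
  have hL := one_le_LL
  have hd' : (0 : ℝ) < d := by linarith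
  have hdn : 0 < d := by exact_mod_cast hd'
  have hst : (s : ℕ) < t := hs
  have a1 : LL / d ≤ 1 / 8 := by rw [div_le_iff₀ hd']; linarith
  have b1 : mProb n q (fun π => mx t π = t) ≤ 1 / 8 :=
    (prob_mx_self hq hq1 hdn hd ht).trans a1
  have b2 : mProb n q (fun π => mx s π = s) ≤ 1 / 8 :=
    (prob_mx_self hq hq1 hdn hd (by omega)).trans a1
  have b3 : mProb n q (fun π => ∃ v ∈ Finset.Ioc s t, mx s π = (v : ℕ)) ≤ 1 / 4 := by
    refine (mProb_exists_le hq0 _ _).trans ?_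
    have : ∀ v ∈ Finset.Ioc s t, mProb n q (fun π => mx s π = (v : ℕ)) ≤ LL / (d : ℝ) ^ 2 := by
      intro v hv
      rw [Finset.mem_Ioc, Fin.lt_def, Fin.le_def] at hv
      exact prob_mx_eq hq hq1 hdn hd (Fin.lt_def.2 hv.1) (by omega)
    refine (Finset.sum_le_sum this).trans ?_
    rw [Finset.sum_const, nsmul_eq_mul, Fin.card_Ioc, Nat.cast_sub hst.le, ← mul_div_assoc,
      div_le_iff₀ (by positivity)]
    linarith
  obtain ⟨k, hk1, hk2⟩ : ∃ k : ℕ, 4 ≤ (k : ℝ) * (1 - q) ∧ (k : ℝ) * (1 - q) ≤ 5 := by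
    refine ⟨⌈4 / (1 - q)⌉₊, ?_, ?_⟩
    · have := Nat.le_ceil (4 / (1 - q)); rwa [div_le_iff₀ hε] at this
    · have := (Nat.ceil_lt_add_one (show 0 ≤ 4 / (1 - q) by positivity)).le
      have h2 := mul_le_mul_of_nonneg_right this hε.le
      rw [add_mul, div_mul_cancel₀ _ hε.ne'] at h2
      linarith
  have b4 : mProb n q (fun π => (t : ℕ) + 1 ≤ mx s π ∧ k < kap (t + 1) π) ≤ 1 / 4 := by
    have x1 := kap_markov hq0 s ((t : ℕ) + 1) k
    have x2 := exp_kap_BB hq0 hq1 s ((t : ℕ) + 1)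
    have x3 := BB_le hq0 hq1 s ((t : ℕ) + 1)
    have x4 := mProb_nonneg (n := n) hq0 (fun π => (t : ℕ) + 1 ≤ mx s π ∧ k < kap (t + 1) π)
    have x5 := (x1.trans x2).trans x3
    rw [le_div_iff₀ hε] at x5
    generalize mProb n q (fun π => (t : ℕ) + 1 ≤ mx s π ∧ k < kap (t + 1) π) = p at *
    nlinarith
  have c0 := merge_prob hq0 hq1 hs k
  have c2 : (1 : ℝ) ≤ mProb n q (fun π => ((t : ℕ) + 1 ≤ mx s π ∧ (t : ℕ) + 1 ≤ mx t π ∧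
      kap (t + 1) π ≤ k) ∧ ¬ π.SameCycle s t) + (mProb n q (fun π => π.SameCycle s t) +
      (mProb n q (fun π => mx t π = t) + (mProb n q (fun π => mx s π = s) +
      (mProb n q (fun π => ∃ v ∈ Finset.Ioc s t, mx s π = (v : ℕ)) +
      mProb n q (fun π => (t : ℕ) + 1 ≤ mx s π ∧ k < kap (t + 1) π))))) := by
    rw [← mProb_true (n := n) hq0]
    refine le_trans (mProb_mono hq0 ?_) ((mProb_or_le hq0 _ _).trans
      (add_le_add_right ((mProb_or_le hq0 _ _).trans
      (add_le_add_right ((mProb_or_le hq0 _ _).trans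
      (add_le_add_right ((mProb_or_le hq0 _ _).trans
      (add_le_add_right (mProb_or_le hq0 _ _) _)) _)) _)) _))
    intro π _
    by_cases h1 : π.SameCycle s t
    · exact Or.inr (Or.inl h1)
    by_cases h2 : (t : ℕ) + 1 ≤ mx t π
    · by_cases h3 : (t : ℕ) + 1 ≤ mx s π
      · by_cases h4 : k < kap (t + 1) π
        · exact Or.inr (Or.inr (Or.inr (Or.inr (Or.inr ⟨h3, h4⟩))))
        · exact Or.inl ⟨⟨h3, h2, not_lt.1 h4⟩, h1⟩
      · have := self_le_mx s π
        by_cases h5 : mx s π = s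
        · exact Or.inr (Or.inr (Or.inr (Or.inl h5)))
        · refine Or.inr (Or.inr (Or.inr (Or.inr (Or.inl ⟨⟨mx s π, mx_lt s π⟩, ?_, rfl⟩))))
          rw [Finset.mem_Ioc, Fin.lt_def, Fin.le_def]
          exact ⟨by show (s : ℕ) < mx s π; omega, by show mx s π ≤ (t : ℕ); omega⟩
    · have := self_le_mx t π
      exact Or.inr (Or.inr (Or.inl (by omega)))
  have c3 : Real.exp (-(3 * 11)) ≤ q ^ (1 + 2 * k) := by
    refine q_pow_lower (by linarith) hq1 _ _ ?_
    push_cast; nlinarith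
  have c4 : Real.exp (-33) ≤ 1 := Real.exp_le_one_iff.2 (by norm_num)
  rw [show (-(3 * 11) : ℝ) = -33 by norm_num] at c3
  have c5 := mProb_nonneg (n := n) hq0 (fun π => π.SameCycle s t)
  have c6 := mProb_nonneg (n := n) hq0 (fun π => ((t : ℕ) + 1 ≤ mx s π ∧ (t : ℕ) + 1 ≤ mx t π ∧
      kap (t + 1) π ≤ k) ∧ ¬ π.SameCycle s t)
  have c7 : 1 / 4 ≤ mProb n q (fun π => ((t : ℕ) + 1 ≤ mx s π ∧ (t : ℕ) + 1 ≤ mx t π ∧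
      kap (t + 1) π ≤ k) ∧ ¬ π.SameCycle s t) + mProb n q (fun π => π.SameCycle s t) := by
    linarith
  have c8 := (mul_le_mul_of_nonneg_right c3 c6).trans c0
  clear c0 c2 b1 b2 b3 b4
  generalize mProb n q (fun π => ((t : ℕ) + 1 ≤ mx s π ∧ (t : ℕ) + 1 ≤ mx t π ∧
      kap (t + 1) π ≤ k) ∧ ¬ π.SameCycle s t) = x at *
  generalize mProb n q (fun π => π.SameCycle s t) = y at *
  have hE : 0 < Real.exp (-33) := Real.exp_pos _
  unfold c1
  generalize Real.exp (-33) = E at *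
  have z1 := mul_le_mul_of_nonneg_left c7 hE.le
  have z2 := mul_le_mul_of_nonneg_right c4 c5
  linarith

lemma exp_card {n : ℕ} {q : ℝ} (s : Fin n) :
    mExp n q (fun π => ((cycleSet n π s).card : ℝ)) =
      ∑ t : Fin n, mProb n q (fun π => π.SameCycle s t) := by
  simp only [← mExp_ite]
  rw [← mExp_sum]
  congr 1
  funext π
  unfold cycleSet
  rw [Finset.card_filter]
  push_cast
  rfl

lemma EX_ge {n : ℕ} {q : ℝ} (hq : 1 / 2 ≤ q) (hq1 : q < 1) {s : Fin n} {d M : ℕ}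
    (hd0 : 8 * LL ≤ d) (hd : (d : ℝ) * (1 - q) ≤ 1) (hM : (M : ℝ) * (4 * LL) ≤ (d : ℝ) ^ 2)
    (hs : (s : ℕ) + M + d < n) :
    c1 * M ≤ mExp n q (fun π => ((cycleSet n π s).card : ℝ)) := by
  have hL := one_le_LL
  rw [exp_card]
  have hb : (s : ℕ) + M < n := by omega
  have h1 : ∑ t ∈ Finset.Ioc s ⟨s + M, hb⟩, c1 ≤ ∑ t : Fin n, mProb n q (fun π => π.SameCycle s t) := by
    refine le_trans (Finset.sum_le_sum (g := fun t => mProb n q (fun π => π.SameCycle s t)) ?_)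
      (Finset.sum_le_sum_of_subset_of_nonneg (Finset.subset_univ _)
        fun t _ _ => mProb_nonneg (by linarith) _)
    intro t ht
    rw [Finset.mem_Ioc, Fin.lt_def, Fin.le_def] at ht
    have h2 : (t : ℕ) ≤ s + M := ht.2
    refine prob_connect hq hq1 hd0 hd (Fin.lt_def.2 ht.1) (by omega) (le_trans ?_ hM)
    have h3 : (t : ℝ) ≤ s + M := by exact_mod_cast h2
    apply mul_le_mul_of_nonneg_right _ (by linarith)
    linarith
  rw [Finset.sum_const, nsmul_eq_mul, Fin.card_Ioc] at h1
  simp only [Nat.add_sub_cancel_left] at h1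
  linarith

/-- The absolute constant of the second moment lower bound. -/
def c2 : ℝ := c1 ^ 2 / (36 * LL) ^ 4

lemma sq_exp_le {n : ℕ} {q : ℝ} (hq : 0 < q) (X : Equiv.Perm (Fin n) → ℝ) :
    mExp n q X ^ 2 ≤ mExp n q (fun π => X π ^ 2) := by
  set m := mExp n q X with hm
  have h : 0 ≤ mExp n q (fun π => (X π - m) ^ 2) := mExp_nonneg hq fun _ => sq_nonneg _
  have e1 : (fun π => (X π - m) ^ 2) = fun π => X π ^ 2 + ((-(2 * m)) * X π + m ^ 2) := by
    funext π; ring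
  rw [e1, mExp_add, mExp_add, mExp_smul, mExp_const hq, ← hm] at h
  linarith

lemma min_pow_le {x y a : ℝ} (hx : 0 ≤ x) (hy : 0 ≤ y) (h : min x y ≤ a) :
    min (x ^ 2) (y ^ 2) ≤ a ^ 2 := by
  rcases min_le_iff.1 h with h | h
  · exact (min_le_left _ _).trans (pow_le_pow_left₀ hx h 2)
  · exact (min_le_right _ _).trans (pow_le_pow_left₀ hy h 2)

lemma second_moment_half {n : ℕ} {q : ℝ} (hq : 1 / 2 ≤ q) (hq1 : q < 1) (s : Fin n)
    (hs : 2 * (s : ℕ) + 1 ≤ n) :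
    c2 * min (1 / (1 - q) ^ 4) ((n : ℝ) ^ 2) ≤
      mExp n q (fun π => ((cycleSet n π s).card : ℝ) ^ 2) := by
  have hq0 : 0 < q := by linarith
  have hε : 0 < 1 - q := by linarith
  have hL := one_le_LL
  have hc1 := c1_pos
  have hc1' := c1_le_one
  have hLp : 0 < (36 * LL) ^ 4 := by positivity
  set e := 1 - q with he
  have he2 : e ≤ 1 / 2 := by linarith
  have rw1 : 1 / e ^ 4 = (1 / e ^ 2) ^ 2 := by field_simp
  -- trivial bound
  have triv : 1 ≤ mExp n q (fun π => ((cycleSet n π s).card : ℝ) ^ 2) := by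
    have : mExp n q (fun _ => (1 : ℝ)) ≤ mExp n q (fun π => ((cycleSet n π s).card : ℝ) ^ 2) := by
      refine mExp_mono hq0 fun π => ?_
      have : (1 : ℝ) ≤ (cycleSet n π s).card := by exact_mod_cast one_le_card s π
      nlinarith
    rwa [mExp_const hq0] at this
  have small : min (1 / e ^ 2) (n : ℝ) ≤ (36 * LL) ^ 2 →
      c2 * min (1 / e ^ 4) ((n : ℝ) ^ 2) ≤
        mExp n q (fun π => ((cycleSet n π s).card : ℝ) ^ 2) := by
    intro h
    have h1 := min_pow_le (by positivity) (Nat.cast_nonneg n) h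
    rw [← rw1] at h1
    refine le_trans ?_ triv
    unfold c2
    rw [div_mul_eq_mul_div, div_le_one hLp]
    have h2 : c1 ^ 2 ≤ 1 := pow_le_one₀ hc1.le hc1'
    have h3 : 0 ≤ min (1 / e ^ 4) ((n : ℝ) ^ 2) := le_min (by positivity) (by positivity)
    nlinarith
  set d := min ⌊1 / e⌋₊ (n / 4) with hd
  have hde : (d : ℝ) * e ≤ 1 := by
    have h1 : (d : ℝ) ≤ (⌊1 / e⌋₊ : ℝ) := by exact_mod_cast min_le_left _ _
    have h2 := Nat.floor_le (show 0 ≤ 1 / e by positivity)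
    have h3 := h1.trans h2
    rwa [le_div_iff₀ hε] at h3
  have hdn : d ≤ n / 4 := min_le_right _ _
  rcases lt_or_ge (d : ℝ) (8 * LL) with hds | hds
  · apply small
    rcases min_choice ⌊1 / e⌋₊ (n / 4) with h | h
    · rw [← hd] at h
      have h1 := (Nat.lt_floor_add_one (1 / e)).le
      rw [← h] at h1
      have h2 : 1 / e ≤ 36 * LL := by linarith
      refine (min_le_left _ _).trans ?_
      rw [← one_div_pow]
      exact pow_le_pow_left₀ (by positivity) h2 2
    · rw [← hd] at h
      have h1 : n ≤ 4 * d + 4 := by omega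
      have h2 : (n : ℝ) ≤ 4 * d + 4 := by exact_mod_cast h1
      refine (min_le_right _ _).trans ?_
      nlinarith
  · have hd8 : (8 : ℝ) ≤ d := by linarith
    have hd8' : 8 ≤ d := by exact_mod_cast hd8
    set M := min ⌊(d : ℝ) ^ 2 / (4 * LL)⌋₊ (n / 8) with hM
    have hM1 : (M : ℝ) * (4 * LL) ≤ (d : ℝ) ^ 2 := by
      have h1 : (M : ℝ) ≤ (⌊(d : ℝ) ^ 2 / (4 * LL)⌋₊ : ℝ) :=
        Nat.cast_le.2 (min_le_left _ _)
      have h2 := Nat.floor_le (show 0 ≤ (d : ℝ) ^ 2 / (4 * LL) by positivity)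
      have h3 := h1.trans h2
      rwa [le_div_iff₀ (by positivity)] at h3
    have hM2 : M ≤ n / 8 := min_le_right _ _
    have hEX := EX_ge hq hq1 (s := s) hds hde hM1 (by omega)
    have hX2 := sq_exp_le hq0 (fun π => ((cycleSet n π s).card : ℝ))
    have hn16 : (n : ℝ) / 16 ≤ (n / 8 : ℕ) := by
      have : n ≤ 16 * (n / 8) := by omega
      have : (n : ℝ) ≤ 16 * (n / 8 : ℕ) := by exact_mod_cast this
      linarith
    have hmin : min (1 / e ^ 2) (n : ℝ) ≤ 32 * LL * M := by
      rcases min_choice ⌊(d : ℝ) ^ 2 / (4 * LL)⌋₊ (n / 8) with h | h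
      · rw [← hM] at h
        have h1 := (Nat.lt_floor_add_one ((d : ℝ) ^ 2 / (4 * LL))).le
        rw [← h, div_le_iff₀ (by positivity)] at h1
        have h2 : 2 * d ≤ (d : ℝ) ^ 2 / (4 * LL) := by
          rw [le_div_iff₀ (by positivity)]; nlinarith
        have h3 : (1 : ℝ) ≤ M := by
          have : 1 ≤ M := by
            rw [h]; apply Nat.le_floor; push_cast; linarith
          exact_mod_cast this
        have h4 : (d : ℝ) ^ 2 ≤ 8 * LL * M := by nlinarith
        rcases min_choice ⌊1 / e⌋₊ (n / 4) with h' | h'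
        · rw [← hd] at h'
          have g1 := (Nat.lt_floor_add_one (1 / e)).le
          rw [← h'] at g1
          have g2 : 1 / e ≤ 2 * d := by linarith
          refine (min_le_left _ _).trans ?_
          rw [← one_div_pow]
          calc (1 / e) ^ 2 ≤ (2 * (d : ℝ)) ^ 2 := pow_le_pow_left₀ (by positivity) g2 2
            _ = 4 * (d : ℝ) ^ 2 := by ring
            _ ≤ _ := by linarith
        · rw [← hd] at h'
          have g1 : n ≤ 8 * d := by omega
          have g2 : (n : ℝ) ≤ 8 * d := by exact_mod_cast g1
          refine (min_le_right _ _).trans ?_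
          nlinarith
      · rw [← hM] at h
        refine (min_le_right _ _).trans ?_
        rw [← h] at hn16
        have : (0 : ℝ) ≤ M := Nat.cast_nonneg M
        nlinarith
    have h1 := min_pow_le (by positivity) (Nat.cast_nonneg n) hmin
    rw [← rw1] at h1
    have hM0 : (0 : ℝ) ≤ M := Nat.cast_nonneg M
    have h2 : (c1 * M) ^ 2 ≤ mExp n q (fun π => ((cycleSet n π s).card : ℝ) ^ 2) :=
      (pow_le_pow_left₀ (by positivity) hEX 2).trans hX2
    refine le_trans ?_ h2
    unfold c2
    rw [div_mul_eq_mul_div, div_le_iff₀ hLp, mul_pow, mul_assoc]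
    apply mul_le_mul_of_nonneg_left _ (sq_nonneg c1)
    refine h1.trans ?_
    have h3 : (32 * LL) ^ 2 ≤ (36 * LL) ^ 4 := by
      calc (32 * LL) ^ 2 ≤ (36 * LL) ^ 2 := pow_le_pow_left₀ (by linarith) (by linarith) 2
        _ ≤ (36 * LL) ^ 4 := pow_le_pow_right₀ (by linarith) (by norm_num)
    rw [mul_pow, mul_comm]
    exact mul_le_mul_of_nonneg_left h3 (sq_nonneg _)

lemma card_revConj {n : ℕ} (s : Fin n) (π : Equiv.Perm (Fin n)) :
    (cycleSet n (revConj π) (Fin.rev s)).card = (cycleSet n π s).card := by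
  refine Finset.card_bij' (fun x _ => Fin.rev x) (fun x _ => Fin.rev x) ?_ ?_ ?_ ?_
  · intro x hx
    rw [mem_cycleSet] at hx ⊢
    have := sameCycle_revConj hx
    rwa [revConj_revConj, Fin.rev_rev] at this
  · intro x hx
    rw [mem_cycleSet] at hx ⊢
    exact sameCycle_revConj hx
  · intro x _; simp
  · intro x _; simp

lemma second_moment {n : ℕ} {q : ℝ} (hq : 1 / 2 ≤ q) (hq1 : q < 1) (s : Fin n) :
    c2 * min (1 / (1 - q) ^ 4) ((n : ℝ) ^ 2) ≤
      mExp n q (fun π => ((cycleSet n π s).card : ℝ) ^ 2) := by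
  rcases le_or_gt (2 * (s : ℕ) + 1) n with h | h
  · exact second_moment_half hq hq1 s h
  · have h1 := second_moment_half hq hq1 (Fin.rev s) (by
      rw [Fin.val_rev]; have := s.2; omega)
    rw [← mExp_revConj] at h1
    simpa only [card_revConj] using h1

lemma c2_pos : 0 < c2 := by
  have h1 := c1_pos
  have h2 := one_le_LL
  unfold c2
  positivity

lemma c2_le_one : c2 ≤ 1 := by
  have h1 := c1_pos
  have h2 := one_le_LL
  unfold c2
  rw [div_le_one (by positivity)]
  calc c1 ^ 2 ≤ 1 := pow_le_one₀ h1.le c1_le_one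
    _ ≤ _ := one_le_pow₀ (by linarith)

lemma lower {n : ℕ} {q : ℝ} (hn : 1 ≤ n) (hq : 0 < q) (hq1 : q < 1) (s : Fin n) :
    c2 / 672 * min (q / (1 - q) ^ 4) (((n : ℝ) - 1) ^ 2) ≤
      mVar n q (fun π => ((cycleSet n π s).card : ℝ)) := by
  have hε : 0 < 1 - q := by linarith
  have k1 := c2_pos
  have k2 := c2_le_one
  rcases hn.eq_or_lt with rfl | hn
  · have : mVar 1 q (fun π => ((cycleSet 1 π s).card : ℝ)) ≥ 0 := mExp_nonneg hq fun _ => sq_nonneg _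
    refine le_trans ?_ this
    have h : min (q / (1 - q) ^ 4) ((((1 : ℕ) : ℝ) - 1) ^ 2) ≤ 0 := by
      refine (min_le_right _ _).trans ?_; norm_num
    nlinarith
  · obtain ⟨r, hr⟩ : ∃ r : Fin n, Nb s r := by
      by_cases h : (s : ℕ) + 1 < n
      · exact ⟨⟨s + 1, h⟩, Or.inl rfl⟩
      · have := s.2
        exact ⟨⟨s - 1, by omega⟩, Or.inr (by show (s : ℕ) = s - 1 + 1; omega)⟩
    rcases le_or_gt q (1 / 2) with hc | hc
    · refine le_trans ?_ (var_ge_q hq hq1 hr)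
      have h1 : q / (1 - q) ^ 4 ≤ 16 * q := by
        rw [div_le_iff₀ (by positivity)]
        have : (1 / 2 : ℝ) ^ 4 ≤ (1 - q) ^ 4 := pow_le_pow_left₀ (by norm_num) (by linarith) 4
        nlinarith
      have h2 := (min_le_left (q / (1 - q) ^ 4) (((n : ℝ) - 1) ^ 2)).trans h1
      have h3 : c2 / 672 * min (q / (1 - q) ^ 4) (((n : ℝ) - 1) ^ 2) ≤ c2 / 672 * (16 * q) :=
        mul_le_mul_of_nonneg_left h2 (by positivity)
      nlinarith
    · refine le_trans ?_ (var_ge_sq hc.le hq1 hr)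
      have h1 := second_moment hc.le hq1 s
      have hn' : (1 : ℝ) ≤ n := by exact_mod_cast hn.le
      have h2 : min (q / (1 - q) ^ 4) (((n : ℝ) - 1) ^ 2) ≤ min (1 / (1 - q) ^ 4) ((n : ℝ) ^ 2) := by
        apply min_le_min
        · gcongr
        · exact pow_le_pow_left₀ (by linarith) (by linarith) 2
      have h3 := mul_le_mul_of_nonneg_left h2 k1.le
      linarith

theorem mallows_cycle_length_variance :
    ∃ c C : ℝ, 0 < c ∧ 0 < C ∧
      ∀ (n : ℕ) (q : ℝ), 1 ≤ n → 0 < q → q < 1 → ∀ s : Fin n,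
        c * min (q / (1 - q) ^ 4) (((n : ℝ) - 1) ^ 2)
            ≤ mVar n q (fun π => ((cycleSet n π s).card : ℝ)) ∧
          mVar n q (fun π => ((cycleSet n π s).card : ℝ))
            ≤ C * min (q / (1 - q) ^ 4) (((n : ℝ) - 1) ^ 2) := by
  refine ⟨c2 / 672, 800 * (1 + R0) ^ 2, by have := c2_pos; positivity, ?_, ?_⟩
  · have : 0 < R0 := by unfold R0; positivity
    positivity
  · intro n q hn hq hq1 s
    exact ⟨lower hn hq hq1 s, upper hn hq hq1 s⟩
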